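/- arXiv:2002.04790 — 5 statements merged into one kernel-verified Lean document; each statement's English description precedes it below -/
import Mathlib

section
/- Let A be an abelian category with enough projectives and enough injectives, and let X_A be a full resolution of an object A obtained by splicing a projective resolution ··· → P₁ → P₀ → A with an injective coresolution A → I₋₁ → I₋₂ → ···. Define ℓExtⁿ_A(A,B) := Hⁿ[Hom_A(X_A, B)]. Then for all n ≥ 1 there is an isomorphism ℓExtⁿ_A(A,B) ≅ Extⁿ_A(A,B) with the Yoneda Ext group. -/
open CategoryTheory CategoryTheory.Limits

universe w v u

variable {C : Type u} [Category.{v} C] [Abelian C]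

/-- A full resolution of `A`: an everywhere-exact `ℤ`-indexed complex with projective
components in nonnegative degrees and injective components in negative degrees, obtained by
splicing a projective resolution `··· → P₁ → P₀ → A` with an injective coresolution
`A → I₋₁ → I₋₂ → ···` via the composite `P₀ ↠ A ↪ I₋₁`. -/
structure FullResolutionData (A : C) where
  c : ChainComplex C ℤ
  ε : c.X 0 ⟶ A
  η : A ⟶ c.X (-1)
  epi : Epi ε
  mono : Mono η
  fac : c.d 0 (-1) = ε ≫ η
  proj : ∀ n : ℤ, 0 ≤ n → Projective (c.X n)
  inj : ∀ n : ℤ, n < 0 → Injective (c.X n)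
  exact : ∀ n : ℤ, (ShortComplex.mk (c.d (n + 1) n) (c.d n (n - 1)) (c.d_comp_d _ _ _)).Exact

/-- Cocycles in degree `n` of the complex `Hom(c, B)`. -/
noncomputable def cocycles (c : ChainComplex C ℤ) (B : C) (n : ℤ) :
    AddSubgroup (c.X n ⟶ B) :=
  (Preadditive.leftComp B (c.d (n + 1) n)).ker

/-- Coboundaries in degree `n` of the complex `Hom(c, B)`. -/
noncomputable def cobounds (c : ChainComplex C ℤ) (B : C) (n : ℤ) :
    AddSubgroup (c.X n ⟶ B) :=
  (Preadditive.leftComp B (c.d n (n - 1)) :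
    (c.X (n - 1) ⟶ B) →+ (c.X n ⟶ B)).range

/-- The `n`-th cohomology group `Hⁿ[Hom(c, B)]`. -/
noncomputable def cohomologyGrp (c : ChainComplex C ℤ) (B : C) (n : ℤ) :=
  cocycles c B n ⧸ (cobounds c B n).addSubgroupOf (cocycles c B n)

noncomputable instance (c : ChainComplex C ℤ) (B : C) (n : ℤ) :
    AddCommGroup (cohomologyGrp c B n) := by
  unfold cohomologyGrp; infer_instance

/-- Exactness of a full resolution with free indices. -/
lemma FullResolutionData.exact' {A : C} (XA : FullResolutionData A) (i j k : ℤ)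
    (hi : i = j + 1) (hk : k = j - 1) :
    (ShortComplex.mk (XA.c.d i j) (XA.c.d j k) (XA.c.d_comp_d _ _ _)).Exact := by
  subst hi hk
  exact XA.exact j

lemma FullResolutionData.d_ε {A : C} (XA : FullResolutionData A) (i : ℤ) :
    XA.c.d i 0 ≫ XA.ε = 0 := by
  have := XA.mono
  rw [← cancel_mono XA.η, Category.assoc, ← XA.fac, XA.c.d_comp_d, zero_comp]

lemma FullResolutionData.exact_ε {A : C} (XA : FullResolutionData A) :
    (ShortComplex.mk (XA.c.d 1 0) XA.ε (XA.d_ε 1)).Exact := by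
  have := XA.mono
  let φ : ShortComplex.mk (XA.c.d 1 0) XA.ε (XA.d_ε 1) ⟶
      ShortComplex.mk (XA.c.d 1 0) (XA.c.d 0 (-1)) (XA.c.d_comp_d _ _ _) :=
    { τ₁ := 𝟙 _
      τ₂ := 𝟙 _
      τ₃ := XA.η
      comm₁₂ := by simp
      comm₂₃ := by simp [XA.fac] }
  have h1 : Epi φ.τ₁ := inferInstanceAs (Epi (𝟙 _))
  have h2 : IsIso φ.τ₂ := inferInstanceAs (IsIso (𝟙 _))
  have h3 : Mono φ.τ₃ := XA.mono
  exact (ShortComplex.exact_iff_of_epi_of_isIso_of_mono φ).2 (XA.exact' 1 0 (-1) (by simp) (by simp))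

/-- The nonnegative part of a full resolution. -/
noncomputable def FullResolutionData.posPart {A : C} (XA : FullResolutionData A) :
    ChainComplex C ℕ where
  X n := XA.c.X (n : ℤ)
  d i j := XA.c.d (i : ℤ) (j : ℤ)
  shape i j h := XA.c.shape _ _ (by
    simp only [ComplexShape.down_Rel] at h ⊢
    omega)
  d_comp_d' _ _ _ _ _ := XA.c.d_comp_d _ _ _

/-- The augmentation of the nonnegative part. -/
noncomputable def FullResolutionData.posPartπ {A : C} (XA : FullResolutionData A) :
    XA.posPart ⟶ (ChainComplex.single₀ C).obj A :=
  (ChainComplex.toSingle₀Equiv _ _).symm ⟨XA.ε, XA.d_ε 1⟩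

lemma FullResolutionData.posPartπ_f_zero {A : C} (XA : FullResolutionData A) :
    XA.posPartπ.f 0 = XA.ε :=
  ChainComplex.toSingle₀Equiv_symm_apply_f_zero _ _

lemma FullResolutionData.quasiIso_posPartπ {A : C} (XA : FullResolutionData A) :
    QuasiIso XA.posPartπ := ⟨fun n => by
  cases n with
  | zero =>
    rw [ChainComplex.quasiIsoAt₀_iff, ShortComplex.quasiIso_iff_of_zeros']
    · refine (ShortComplex.exact_and_epi_g_iff_of_iso ?_).2 ⟨XA.exact_ε, XA.epi⟩
      exact ShortComplex.isoMk (Iso.refl _) (Iso.refl _) (Iso.refl _)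
        ((Category.id_comp _).trans (Category.comp_id _).symm)
        ((Category.id_comp _).trans (XA.posPartπ_f_zero.symm.trans (Category.comp_id _).symm))
    · exact XA.posPart.shape _ _ (by simp)
    · rfl
    · rfl
  | succ n =>
    rw [quasiIsoAt_iff_exactAt' _ _ (ChainComplex.exactAt_succ_single_obj _ _),
      HomologicalComplex.exactAt_iff' _ (n + 1 + 1) (n + 1) n (by simp) (by simp)]
    exact XA.exact' _ _ _ (by push_cast; ring) (by push_cast; ring)⟩

/-- The projective resolution extracted from a full resolution. -/
noncomputable def FullResolutionData.projRes {A : C} (XA : FullResolutionData A) :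
    ProjectiveResolution A where
  complex := XA.posPart
  projective n := XA.proj n (by omega)
  π := XA.posPartπ
  quasiIso := XA.quasiIso_posPartπ

/-- The map from cocycles to `Ext`. -/
noncomputable def cocyclesToExt [HasExt.{w} C] {A : C} (XA : FullResolutionData A) (B : C)
    (n : ℕ) : cocycles XA.c B (n : ℤ) →+ Abelian.Ext A B n :=
  AddMonoidHom.mk' (fun f => XA.projRes.extMk (n := n) f.1 (n + 1) rfl f.2)
    (fun f g => (XA.projRes.add_extMk (n := n) f.1 g.1 (n + 1) rfl f.2 g.2).symm)

lemma cocyclesToExt_surjective [HasExt.{w} C] {A : C} (XA : FullResolutionData A) (B : C)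
    (n : ℕ) : Function.Surjective (cocyclesToExt XA B n) := fun α => by
  obtain ⟨f, hf, h⟩ := XA.projRes.extMk_surjective α (n + 1) rfl
  exact ⟨⟨f, hf⟩, h⟩

lemma cocyclesToExt_ker [HasExt.{w} C] {A : C} (XA : FullResolutionData A) (B : C)
    (n : ℕ) (hn : 1 ≤ n) : (cobounds XA.c B (n : ℤ)).addSubgroupOf (cocycles XA.c B (n : ℤ)) =
      (cocyclesToExt XA B n).ker := by
  obtain ⟨p, rfl⟩ := Nat.exists_eq_add_of_le' hn
  ext f
  rw [AddSubgroup.mem_addSubgroupOf, AddMonoidHom.mem_ker]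
  refine Iff.trans ?_
    (XA.projRes.extMk_eq_zero_iff (n := p + 1) f.1 (p + 1 + 1) rfl f.2 p rfl).symm
  have key : ∀ q : ℤ, q = p →
      ((∃ g : XA.c.X q ⟶ B, XA.c.d ((p + 1 : ℕ) : ℤ) q ≫ g = f.1) ↔
      ∃ g : XA.c.X (p : ℤ) ⟶ B, XA.c.d ((p + 1 : ℕ) : ℤ) p ≫ g = f.1) := by
    rintro _ rfl
    rfl
  exact key _ (by push_cast; ring)

/-- if `A` has enough projectives and injectives, `X_A` is a full resolution of
`A`, and `ℓExtⁿ(A,B) := Hⁿ[Hom(X_A, B)]`, then for all `n ≥ 1` there is an isomorphism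
`ℓExtⁿ(A,B) ≅ Extⁿ(A,B)` with the Ext group. -/
theorem statement3 [EnoughProjectives C] [EnoughInjectives C] [HasExt.{w} C]
    (A B : C) (XA : FullResolutionData A) (n : ℕ) (hn : 1 ≤ n) :
    Nonempty (cohomologyGrp XA.c B (n : ℤ) ≃+ Abelian.Ext A B n) := by
  exact ⟨(QuotientAddGroup.quotientAddEquivOfEq (cocyclesToExt_ker XA B n hn)).trans
    (QuotientAddGroup.quotientKerEquivOfSurjective _ (cocyclesToExt_surjective XA B n))⟩
end

section
/- Let A be an abelian category with enough projectives and injectives, and let Σ be the suspension on the injective stable category (ΣA is the cokernel of an embedding of A into an injective). Then for every short exact sequence 0 → A → B → C → 0 in A and every object Y there is an exact sequence of abelian groups ··· → Hom_I(ΣC, Y) → Hom_I(ΣB, Y) → Hom_I(ΣA, Y) → Hom_I(C, Y) → Hom_I(B, Y) → Hom_I(A, Y) → Ext¹_A(C, Y) → Ext¹_A(B, Y) → Ext¹_A(A, Y) → Ext²_A(C, Y) → ···, where Hom_I denotes morphisms in the injective stable category. -/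
open CategoryTheory CategoryTheory.Limits

universe w v u

variable {C : Type u} [Category.{v} C] [Abelian C]

/-- Morphisms in the injective stable category: `Hom(X,Y)` modulo the subgroup (generated by)
the morphisms factoring through an injective object. -/
def stHom (X Y : C) :=
  (X ⟶ Y) ⧸ AddSubgroup.closure {f : X ⟶ Y | ∃ I : C, Injective I ∧ ∃ (a : X ⟶ I) (b : I ⟶ Y), f = a ≫ b}

noncomputable instance (X Y : C) : AddCommGroup (stHom X Y) := by
  unfold stHom; infer_instance

namespace St5

/-- stably zero morphisms -/
def Stz {X Y : C} (f : X ⟶ Y) : Prop :=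
  ∃ I : C, Injective I ∧ ∃ (a : X ⟶ I) (b : I ⟶ Y), f = a ≫ b

lemma Stz.add {X Y : C} {f g : X ⟶ Y} (hf : Stz f) (hg : Stz g) : Stz (f + g) := by
  obtain ⟨I, hI, a, b, rfl⟩ := hf
  obtain ⟨K, hK, c, d, rfl⟩ := hg
  exact ⟨I ⊞ K, inferInstance, biprod.lift a c, biprod.desc b d, by simp⟩

lemma Stz.neg {X Y : C} {f : X ⟶ Y} (hf : Stz f) : Stz (-f) := by
  obtain ⟨I, hI, a, b, rfl⟩ := hf
  exact ⟨I, hI, a, -b, by simp⟩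

lemma Stz.zero (X Y : C) : Stz (0 : X ⟶ Y) :=
  ⟨_, (isZero_zero C).injective, 0, 0, by simp⟩

lemma Stz.pre {X Y Z : C} {f : X ⟶ Y} (g : Z ⟶ X) (hf : Stz f) : Stz (g ≫ f) := by
  obtain ⟨I, hI, a, b, rfl⟩ := hf
  exact ⟨I, hI, g ≫ a, b, by simp⟩

lemma Stz.post {X Y Z : C} {f : X ⟶ Y} (hf : Stz f) (g : Y ⟶ Z) : Stz (f ≫ g) := by
  obtain ⟨I, hI, a, b, rfl⟩ := hf
  exact ⟨I, hI, a, b ≫ g, by simp⟩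

/-- the quotient map -/
noncomputable def q (X Y : C) : (X ⟶ Y) →+ stHom X Y :=
  QuotientAddGroup.mk' (AddSubgroup.closure
    {f : X ⟶ Y | ∃ I : C, Injective I ∧ ∃ (a : X ⟶ I) (b : I ⟶ Y), f = a ≫ b})

lemma q_surj (X Y : C) : Function.Surjective (q X Y) :=
  QuotientAddGroup.mk'_surjective _

lemma mem_closure_iff {X Y : C} (f : X ⟶ Y) : f ∈ AddSubgroup.closure
    {f : X ⟶ Y | ∃ I : C, Injective I ∧ ∃ (a : X ⟶ I) (b : I ⟶ Y), f = a ≫ b} ↔ Stz f := by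
  constructor
  · intro h
    induction h using AddSubgroup.closure_induction with
    | mem x hx => exact hx
    | zero => exact Stz.zero _ _
    | add x y _ _ hx hy => exact hx.add hy
    | neg x _ hx => exact hx.neg
  · intro h
    exact AddSubgroup.subset_closure h

lemma q_eq_zero {X Y : C} (f : X ⟶ Y) : q X Y f = 0 ↔ Stz f := by
  rw [← mem_closure_iff]
  exact QuotientAddGroup.eq_zero_iff f

lemma q_eq {X Y : C} (f g : X ⟶ Y) : q X Y f = q X Y g ↔ Stz (f - g) := by
  rw [← q_eq_zero, map_sub, sub_eq_zero]

/-- lifting additive maps to the quotient -/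
noncomputable def lft {X Y : C} {G : Type*} [AddCommGroup G] (φ : (X ⟶ Y) →+ G)
    (h : ∀ f, Stz f → φ f = 0) : stHom X Y →+ G :=
  QuotientAddGroup.lift _ φ (fun f hf => h f ((mem_closure_iff f).1 hf))

@[simp]
lemma lft_q {X Y : C} {G : Type*} [AddCommGroup G] (φ : (X ⟶ Y) →+ G)
    (h : ∀ f, Stz f → φ f = 0) (f : X ⟶ Y) : lft φ h (q X Y f) = φ f := rfl

/-- precomposition -/
noncomputable def pre {X X' : C} (f : X ⟶ X') (Y : C) : stHom X' Y →+ stHom X Y :=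
  lft ((q X Y).comp (Preadditive.leftComp Y f)) (fun g hg => by
    exact (q_eq_zero _).2 (hg.pre f))

@[simp]
lemma pre_q {X X' Y : C} (f : X ⟶ X') (g : X' ⟶ Y) : pre f Y (q X' Y g) = q X Y (f ≫ g) := rfl

lemma pre_comp {X X' X'' Y : C} (f : X ⟶ X') (g : X' ⟶ X'') (x : stHom X'' Y) :
    pre (f ≫ g) Y x = pre f Y (pre g Y x) := by
  obtain ⟨x, rfl⟩ := q_surj _ _ x
  simp

lemma pre_congr {X X' Y : C} {f g : X ⟶ X'} (h : Stz (f - g)) (x : stHom X' Y) :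
    pre f Y x = pre g Y x := by
  obtain ⟨x, rfl⟩ := q_surj _ _ x
  simp only [pre_q, q_eq, ← Preadditive.sub_comp]
  exact h.post x

lemma pre_id {X Y : C} (x : stHom X Y) : pre (𝟙 X) Y x = x := by
  obtain ⟨x, rfl⟩ := q_surj _ _ x
  simp

/-- stable isomorphism -/
def StIso (X X' : C) : Prop :=
  ∃ (f : X ⟶ X') (g : X' ⟶ X), Stz (f ≫ g - 𝟙 X) ∧ Stz (g ≫ f - 𝟙 X')

lemma StIso.refl (X : C) : StIso X X :=
  ⟨𝟙 X, 𝟙 X, by simpa using Stz.zero X X, by simpa using Stz.zero X X⟩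

lemma StIso.symm {X Y : C} (h : StIso X Y) : StIso Y X := by
  obtain ⟨f, g, h1, h2⟩ := h
  exact ⟨g, f, h2, h1⟩

lemma stz_trans {X Y Z : C} {f : X ⟶ Y} {g : Y ⟶ X} {f' : Y ⟶ Z} {g' : Z ⟶ Y}
    (h : Stz (f ≫ g - 𝟙 X)) (h' : Stz (f' ≫ g' - 𝟙 Y)) :
    Stz ((f ≫ f') ≫ (g' ≫ g) - 𝟙 X) := by
  have := (((h'.pre f).post g).add h)
  convert this using 1
  simp

lemma StIso.trans {X Y Z : C} (h : StIso X Y) (h' : StIso Y Z) : StIso X Z := by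
  obtain ⟨f, g, h1, h2⟩ := h
  obtain ⟨f', g', h1', h2'⟩ := h'
  exact ⟨f ≫ f', g' ≫ g, stz_trans h1 h1', stz_trans h2' h2⟩

lemma StIso.biprod (X I : C) [Injective I] : StIso X (X ⊞ I) := by
  refine ⟨biprod.inl, biprod.fst, by simpa using Stz.zero X X, ?_⟩
  refine ⟨I, inferInstance, -biprod.snd, biprod.inr, ?_⟩
  rw [← biprod.total, Preadditive.neg_comp]
  abel

/-- the induced isomorphism of groups -/
lemma StIso.equiv {X X' : C} (h : StIso X X') (Y : C) : Nonempty (stHom X Y ≃+ stHom X' Y) := by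
  obtain ⟨f, g, h1, h2⟩ := h
  refine ⟨{ toFun := pre g Y, invFun := pre f Y, map_add' := map_add _, left_inv := ?_,
            right_inv := ?_ }⟩
  · intro x
    rw [← pre_comp, pre_congr h1, pre_id]
  · intro x
    rw [← pre_comp, pre_congr h2, pre_id]

/-- Suspension data. -/
def IsSusp (X Q : C) : Prop :=
  ∃ (I : C) (_ : Injective I) (j : X ⟶ I) (π : I ⟶ Q) (w : j ≫ π = 0),
    (ShortComplex.mk j π w).ShortExact

lemma exists_desc {X I Q Z : C} {j : X ⟶ I} {π : I ⟶ Q} {w : j ≫ π = 0}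
    (h : (ShortComplex.mk j π w).ShortExact) (k : I ⟶ Z) (hk : j ≫ k = 0) :
    ∃ l : Q ⟶ Z, π ≫ l = k := by
  have := h.epi_g
  exact ⟨h.exact.desc k hk, h.exact.g_desc k hk⟩

lemma exists_lift {X I Q Z : C} {j : X ⟶ I} {π : I ⟶ Q} {w : j ≫ π = 0}
    (h : (ShortComplex.mk j π w).ShortExact) (k : Z ⟶ I) (hk : k ≫ π = 0) :
    ∃ l : Z ⟶ X, l ≫ j = k := by
  have := h.mono_f
  exact ⟨h.exact.lift k hk, h.exact.lift_f k hk⟩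

lemma susp_stz {X I Q X' I' Q' : C} {j : X ⟶ I} {π : I ⟶ Q} {w : j ≫ π = 0}
    (h : (ShortComplex.mk j π w).ShortExact)
    {j' : X' ⟶ I'} {π' : I' ⟶ Q'} {w' : j' ≫ π' = 0} (hI' : Injective I')
    (φ : X ⟶ X') (Φ : I ⟶ I') (ψ : Q ⟶ Q') (h1 : j ≫ Φ = φ ≫ j') (h2 : π ≫ ψ = Φ ≫ π')
    (hφ : Stz φ) : Stz ψ := by
  obtain ⟨K, hK, a, b, rfl⟩ := hφ
  have := h.mono_f
  have : Mono j := h.mono_f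
  have : Epi π := h.epi_g
  let a' := Injective.factorThru a j
  have ha' : j ≫ a' = a := Injective.comp_factorThru a j
  obtain ⟨s, hs⟩ := exists_desc h (Φ - a' ≫ b ≫ j') (by
    rw [Preadditive.comp_sub, h1, ← ha']; simp)
  refine ⟨I', hI', s, π', ?_⟩
  rw [← cancel_epi π, reassoc_of% hs, h2]
  simp [w']

lemma susp_map {X I Q X' I' Q' : C} {j : X ⟶ I} {π : I ⟶ Q} {w : j ≫ π = 0}
    (h : (ShortComplex.mk j π w).ShortExact)
    {j' : X' ⟶ I'} {π' : I' ⟶ Q'} (w' : j' ≫ π' = 0) (hI' : Injective I')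
    (φ : X ⟶ X') : ∃ (Φ : I ⟶ I') (ψ : Q ⟶ Q'), j ≫ Φ = φ ≫ j' ∧ π ≫ ψ = Φ ≫ π' := by
  have : Mono j := h.mono_f
  have h1 : j ≫ Injective.factorThru (φ ≫ j') j = φ ≫ j' := Injective.comp_factorThru _ _
  obtain ⟨s, hs⟩ := exists_desc h (Injective.factorThru (φ ≫ j') j ≫ π') (by
    rw [reassoc_of% h1, w', comp_zero])
  exact ⟨_, s, h1, hs⟩

lemma StIso.susp {X X' Q Q' : C} (h : StIso X X') (hX : IsSusp X Q) (hX' : IsSusp X' Q') :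
    StIso Q Q' := by
  obtain ⟨I, hI, j, π, w, hs⟩ := hX
  obtain ⟨I', hI', j', π', w', hs'⟩ := hX'
  obtain ⟨f, g, hfg, hgf⟩ := h
  obtain ⟨F, f', h1, h2⟩ := susp_map hs w' hI' f
  obtain ⟨G, g', h3, h4⟩ := susp_map hs' w hI g
  refine ⟨f', g', ?_, ?_⟩
  · refine susp_stz hs (w' := w) hI (f ≫ g - 𝟙 X) (F ≫ G - 𝟙 I) _ ?_ ?_ hfg
    · simp [reassoc_of% h1, h3]
    · simp [reassoc_of% h2, h4]
  · refine susp_stz hs' (w' := w') hI' (g ≫ f - 𝟙 X') (G ≫ F - 𝟙 I') _ ?_ ?_ hgf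
    · simp [reassoc_of% h3, h1]
    · simp [reassoc_of% h4, h2]

lemma exact_pre {A B D : C} {i : A ⟶ B} {p : B ⟶ D} {w : i ≫ p = 0}
    (h : (ShortComplex.mk i p w).ShortExact) (Y : C) :
    Function.Exact (pre p Y) (pre i Y) := by
  intro x
  constructor
  · intro hx
    obtain ⟨f, rfl⟩ := q_surj _ _ x
    rw [pre_q, q_eq_zero] at hx
    obtain ⟨I, hI, a, b, hab⟩ := hx
    have : Mono i := h.mono_f
    have ha : i ≫ Injective.factorThru a i = a := Injective.comp_factorThru a i
    obtain ⟨l, hl⟩ := exists_desc h (f - Injective.factorThru a i ≫ b) (by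
      rw [Preadditive.comp_sub, hab, reassoc_of% ha, sub_self])
    refine ⟨q _ _ l, ?_⟩
    rw [pre_q, q_eq, hl]
    exact ⟨I, hI, -Injective.factorThru a i, b, by simp⟩
  · rintro ⟨y, rfl⟩
    rw [← pre_comp, w]
    obtain ⟨f, rfl⟩ := q_surj _ _ y
    simp

/-- Rotation of a short exact sequence. -/
lemma exists_rot [EnoughInjectives C] (T : ShortComplex C) (hT : T.ShortExact) :
    ∃ (Q I : C) (_ : Injective I) (_ : IsSusp T.X₁ Q) (ε : T.X₂ ⟶ I) (r : T.X₃ ⊞ I ⟶ Q)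
      (w : biprod.lift T.g ε ≫ r = 0), (ShortComplex.mk (biprod.lift T.g ε) r w).ShortExact := by
  rcases T with @⟨A, B, D, i, p, w⟩
  have : Mono i := hT.mono_f
  have : Epi p := hT.epi_g
  let I := Injective.under A
  let j : A ⟶ I := Injective.ι A
  have hj : (ShortComplex.mk j (cokernel.π j) (cokernel.condition j)).ShortExact :=
    { exact := ShortComplex.exact_cokernel j
      mono_f := inferInstanceAs (Mono (Injective.ι A))
      epi_g := inferInstanceAs (Epi (cokernel.π j)) }
  have : Mono j := hj.mono_f
  let ε : B ⟶ I := Injective.factorThru j i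
  have hε : i ≫ ε = j := Injective.comp_factorThru j i
  obtain ⟨γ, hγ⟩ := exists_desc hT (-(ε ≫ cokernel.π j)) (by
    rw [Preadditive.comp_neg, reassoc_of% hε, cokernel.condition, neg_zero])
  refine ⟨cokernel j, I, inferInstanceAs (Injective (Injective.under A)),
    ⟨I, inferInstanceAs (Injective (Injective.under A)), j, _, _, hj⟩, ε,
    biprod.desc γ (cokernel.π j), ?_, ?_⟩
  · simp [hγ]
  · refine ShortComplex.ShortExact.mk' ?_ ?_ ?_
    · rw [ShortComplex.exact_iff_exact_up_to_refinements]
      intro Z x hx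
      dsimp at x hx
      obtain ⟨Z', π, hπ, b, hb⟩ := surjective_up_to_refinements_of_epi p (x ≫ biprod.fst)
      have hx' : x ≫ biprod.fst ≫ γ + x ≫ biprod.snd ≫ cokernel.π j = 0 := by
        rw [← hx, biprod.desc_eq, Preadditive.comp_add]
      obtain ⟨c, hc⟩ := exists_lift hj (π ≫ x ≫ biprod.snd - b ≫ ε) (by
        have h1 : π ≫ x ≫ biprod.fst ≫ γ = -(b ≫ ε ≫ cokernel.π j) := by
          have := congrArg (· ≫ γ) hb
          simpa [hγ] using this
        have h2 := congrArg (π ≫ ·) hx'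
        simp only [Preadditive.comp_add, h1, comp_zero] at h2
        simp only [Preadditive.sub_comp, Category.assoc]
        rw [sub_eq_add_neg, add_comm]
        exact h2)
      refine ⟨Z', π, hπ, b + c ≫ i, ?_⟩
      dsimp
      apply biprod.hom_ext
      · simp [hb, w]
      · simp [hε, hc]
    · dsimp
      rw [Preadditive.mono_iff_cancel_zero]
      intro Z x hx
      have h1 : x ≫ p = 0 := by
        have := congrArg (· ≫ biprod.fst) hx
        simpa using this
      have h2 : x ≫ ε = 0 := by
        have := congrArg (· ≫ biprod.snd) hx
        simpa using this
      obtain ⟨y, rfl⟩ := exists_lift hT x h1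
      rw [Category.assoc, hε] at h2
      rw [(cancel_mono j).1 (h2.trans zero_comp.symm), zero_comp]
    · dsimp
      have : Epi (biprod.inr ≫ biprod.desc γ (cokernel.π j)) := by
        rw [biprod.inr_desc]; infer_instance
      exact epi_of_epi biprod.inr _

/-- bundled short exact sequences -/
abbrev SES (C : Type u) [Category.{v} C] [Abelian C] := {T : ShortComplex C // T.ShortExact}

/-- data of a rotation -/
structure RotData (T : ShortComplex C) where
  Q : C
  I : C
  hI : Injective I
  hQ : IsSusp T.X₁ Q
  ε : T.X₂ ⟶ I
  r : T.X₃ ⊞ I ⟶ Q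
  w : biprod.lift T.g ε ≫ r = 0
  h : (ShortComplex.mk (biprod.lift T.g ε) r w).ShortExact

lemma rotData_nonempty [EnoughInjectives C] (T : SES C) : Nonempty (RotData T.1) := by
  obtain ⟨Q, I, hI, hQ, ε, r, w, h⟩ := exists_rot T.1 T.2
  exact ⟨⟨Q, I, hI, hQ, ε, r, w, h⟩⟩

/-- chosen rotation data -/
noncomputable def rd [EnoughInjectives C] (T : SES C) : RotData T.1 :=
  (rotData_nonempty T).some

/-- the rotated sequence -/
noncomputable def rot [EnoughInjectives C] (T : SES C) : SES C :=
  ⟨_, (rd T).h⟩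

/-- iterated rotation -/
noncomputable def seq [EnoughInjectives C] (T : SES C) : ℕ → SES C
  | 0 => T
  | n + 1 => rot (seq T n)

/-- the objects of the iterated sequence -/
noncomputable def ob [EnoughInjectives C] (T : SES C) (n : ℕ) : C := (seq T n).1.X₁

/-- the maps of the iterated sequence -/
noncomputable def mp [EnoughInjectives C] (T : SES C) (n : ℕ) : ob T n ⟶ ob T (n + 1) :=
  (seq T n).1.f

lemma exact_lift {A B D I : C} {i : A ⟶ B} {p : B ⟶ D} {w : i ≫ p = 0}
    (hT : (ShortComplex.mk i p w).ShortExact) (hI : Injective I) (ε : B ⟶ I) (Y : C) :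
    Function.Exact (pre (biprod.lift p ε) Y) (pre i Y) := by
  have h := exact_pre hT Y
  intro x
  rw [h x]
  constructor
  · rintro ⟨y, rfl⟩
    refine ⟨pre biprod.fst Y y, ?_⟩
    rw [← pre_comp, biprod.lift_fst]
  · rintro ⟨y, rfl⟩
    refine ⟨pre biprod.inl Y y, ?_⟩
    rw [← pre_comp]
    refine pre_congr ?_ y
    refine ⟨I, hI, -ε, biprod.inr, ?_⟩
    apply biprod.hom_ext <;> simp

lemma exact_rot [EnoughInjectives C] (T : SES C) (Y : C) :
    Function.Exact (pre (rot T).1.f Y) (pre T.1.f Y) :=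
  exact_lift T.2 (rd T).hI (rd T).ε Y

lemma exact_mp [EnoughInjectives C] (T : SES C) (Y : C) (n : ℕ) :
    Function.Exact (pre (mp T (n + 1)) Y) (pre (mp T n) Y) :=
  exact_rot (seq T n) Y

lemma stIso_rot [EnoughInjectives C] (T : SES C) : StIso T.1.X₃ (rot T).1.X₂ :=
  have := (rd T).hI
  StIso.biprod _ _

lemma ob_three [EnoughInjectives C] (T : SES C) (n : ℕ) :
    ∃ Q, IsSusp (ob T n) Q ∧ StIso Q (ob T (n + 3)) :=
  ⟨(rd (seq T n)).Q, (rd (seq T n)).hQ, stIso_rot (seq T (n + 1))⟩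

lemma stIso_iter [EnoughInjectives C] (S : C → C) (hS : ∀ X, IsSusp X (S X)) (T : SES C) (k : ℕ)
    (X : C) (h : StIso X (ob T k)) (n : ℕ) : StIso (S^[n] X) (ob T (3 * n + k)) := by
  induction n with
  | zero => simpa using h
  | succ n ih =>
    obtain ⟨Q, h1, h2⟩ := ob_three T (3 * n + k)
    rw [Function.iterate_succ_apply', show 3 * (n + 1) + k = 3 * n + k + 3 by ring]
    exact (ih.susp (hS _) h1).trans h2

lemma exact_conj {G₁ G₂ G₃ H₁ H₂ H₃ : Type*} [AddCommGroup G₁] [AddCommGroup G₂] [AddCommGroup G₃]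
    [AddCommGroup H₁] [AddCommGroup H₂] [AddCommGroup H₃] (e₁ : H₁ ≃+ G₁) (e₂ : H₂ ≃+ G₂)
    (e₃ : H₃ ≃+ G₃) (f : G₁ →+ G₂) (g : G₂ →+ G₃) (h : Function.Exact f g) :
    Function.Exact (e₂.symm.toAddMonoidHom.comp (f.comp e₁.toAddMonoidHom))
      (e₃.symm.toAddMonoidHom.comp (g.comp e₂.toAddMonoidHom)) := by
  intro x
  have := h (e₂ x)
  simp only [AddMonoidHom.comp_apply, AddEquiv.toAddMonoidHom_eq_coe, AddMonoidHom.coe_coe,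
    EmbeddingLike.map_eq_zero_iff, this, Set.mem_range, AddEquiv.symm_apply_eq]
  exact ⟨fun ⟨y, hy⟩ => ⟨e₁.symm y, by simpa using hy⟩, fun ⟨y, hy⟩ => ⟨e₁ y, hy⟩⟩

lemma ext_kill [HasExt.{w} C] {A B D Y : C} {i : A ⟶ B} {p : B ⟶ D} {w : i ≫ p = 0}
    (h : (ShortComplex.mk i p w).ShortExact) (f : B ⟶ Y) :
    h.extClass.comp (Abelian.Ext.mk₀ (i ≫ f)) (add_zero 1) = 0 := by
  have := h.extClass_comp_assoc (Abelian.Ext.mk₀ f) (h := add_zero 1)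
  rwa [Abelian.Ext.mk₀_comp_mk₀] at this

/-- the connecting map to `Ext¹` -/
noncomputable def conn [HasExt.{w} C] {A B D : C} {i : A ⟶ B} {p : B ⟶ D} {w : i ≫ p = 0}
    (h : (ShortComplex.mk i p w).ShortExact) (Y : C) : stHom A Y →+ Abelian.Ext D Y 1 :=
  lft ((h.extClass.precomp Y (add_zero 1)).comp
      (Abelian.Ext.addEquiv₀ (X := A) (Y := Y)).symm.toAddMonoidHom) (by
    rintro _ ⟨I, hI, a, b, rfl⟩
    have : Mono i := h.mono_f
    have ha : i ≫ Injective.factorThru a i = a := Injective.comp_factorThru a i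
    have := ext_kill h (Injective.factorThru a i ≫ b)
    rw [reassoc_of% ha] at this
    exact this)

lemma conn_q [HasExt.{w} C] {A B D : C} {i : A ⟶ B} {p : B ⟶ D} {w : i ≫ p = 0}
    (h : (ShortComplex.mk i p w).ShortExact) (Y : C) (f : A ⟶ Y) :
    conn h Y (q A Y f) = h.extClass.comp (Abelian.Ext.mk₀ f) (add_zero 1) := rfl

lemma exact_conn₁ [HasExt.{w} C] {A B D : C} {i : A ⟶ B} {p : B ⟶ D} {w : i ≫ p = 0}
    (h : (ShortComplex.mk i p w).ShortExact) (Y : C) :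
    Function.Exact (pre i Y) (conn h Y) := by
  intro x
  constructor
  · intro hx
    obtain ⟨f, rfl⟩ := q_surj _ _ x
    rw [conn_q] at hx
    obtain ⟨y, hy⟩ := Abelian.Ext.contravariant_sequence_exact₁ h Y _ _ hx
    obtain ⟨g, rfl⟩ := (Abelian.Ext.mk₀_bijective _ _).2 y
    rw [Abelian.Ext.mk₀_comp_mk₀] at hy
    refine ⟨q _ _ g, ?_⟩
    rw [pre_q]
    exact congrArg _ ((Abelian.Ext.mk₀_bijective _ _).1 hy)
  · rintro ⟨y, rfl⟩
    obtain ⟨g, rfl⟩ := q_surj _ _ y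
    rw [pre_q, conn_q]
    exact ext_kill h g

lemma exact_conn₂ [HasExt.{w} C] {A B D : C} {i : A ⟶ B} {p : B ⟶ D} {w : i ≫ p = 0}
    (h : (ShortComplex.mk i p w).ShortExact) (Y : C) :
    Function.Exact (conn h Y) ((Abelian.Ext.mk₀ p).precomp Y (zero_add 1)) := by
  intro x
  constructor
  · intro hx
    obtain ⟨y, hy⟩ := Abelian.Ext.contravariant_sequence_exact₃ h Y x hx (n₀ := 0) rfl
    obtain ⟨g, rfl⟩ := (Abelian.Ext.mk₀_bijective _ _).2 y
    exact ⟨q _ _ g, hy⟩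
  · rintro ⟨y, rfl⟩
    obtain ⟨g, rfl⟩ := q_surj _ _ y
    rw [conn_q]
    exact h.comp_extClass_assoc _ _

end St5

/-- the long exact sequence
`··· → Hom_I(ΣC,Y) → Hom_I(ΣB,Y) → Hom_I(ΣA,Y) → Hom_I(C,Y) → Hom_I(B,Y) → Hom_I(A,Y)
  → Ext¹(C,Y) → Ext¹(B,Y) → Ext¹(A,Y) → Ext²(C,Y) → ···`
associated to a short exact sequence `0 → A → B → Co → 0` and an object `Y`, where `Σ` is
computed from a chosen embedding of each object into an injective object. -/
theorem statement5 [EnoughProjectives C] [EnoughInjectives C] [HasExt.{w} C]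
    -- the chosen suspension data : `0 → X → J X → S X → 0` with `J X` injective
    (J S : C → C) (ι : ∀ X : C, X ⟶ J X) (π : ∀ X : C, J X ⟶ S X)
    (hJ : ∀ X, Injective (J X)) (wS : ∀ X, ι X ≫ π X = 0)
    (hseS : ∀ X, (ShortComplex.mk (ι X) (π X) (wS X)).ShortExact)
    -- a short exact sequence `0 → A → B → Co → 0` and an object `Y`
    (A B Co Y : C) (i : A ⟶ B) (p : B ⟶ Co) (wip : i ≫ p = 0)
    (hse : (ShortComplex.mk i p wip).ShortExact) :
    ∃ (a : ∀ n : ℕ, stHom (S^[n] Co) Y →+ stHom (S^[n] B) Y)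
      (b : ∀ n : ℕ, stHom (S^[n] B) Y →+ stHom (S^[n] A) Y)
      (δ : ∀ n : ℕ, stHom (S^[n + 1] A) Y →+ stHom (S^[n] Co) Y)
      (e : stHom A Y →+ Abelian.Ext Co Y 1)
      (u : ∀ n : ℕ, Abelian.Ext Co Y (n + 1) →+ Abelian.Ext B Y (n + 1))
      (v : ∀ n : ℕ, Abelian.Ext B Y (n + 1) →+ Abelian.Ext A Y (n + 1))
      (w : ∀ n : ℕ, Abelian.Ext A Y (n + 1) →+ Abelian.Ext Co Y (n + 2)),
      -- the maps between the Ext groups are the canonical ones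
      (∀ (n : ℕ) (x : Abelian.Ext Co Y (n + 1)),
          u n x = (Abelian.Ext.mk₀ p).comp x (zero_add (n + 1))) ∧
      (∀ (n : ℕ) (x : Abelian.Ext B Y (n + 1)),
          v n x = (Abelian.Ext.mk₀ i).comp x (zero_add (n + 1))) ∧
      (∀ (n : ℕ) (x : Abelian.Ext A Y (n + 1)),
          w n x = hse.extClass.comp x (by omega)) ∧
      -- exactness everywhere
      (∀ n, Function.Exact (δ n) (a n)) ∧
      (∀ n, Function.Exact (a n) (b n)) ∧
      (∀ n, Function.Exact (b (n + 1)) (δ n)) ∧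
      Function.Exact (b 0) e ∧
      Function.Exact e (u 0) ∧
      (∀ n, Function.Exact (u n) (v n)) ∧
      (∀ n, Function.Exact (v n) (w n)) ∧
      (∀ n, Function.Exact (w n) (u (n + 1))) := by
  let T : St5.SES C := ⟨_, hse⟩
  have hS : ∀ X, St5.IsSusp X (S X) := fun X => ⟨J X, hJ X, ι X, π X, wS X, hseS X⟩
  let eA := fun n => ((St5.stIso_iter S hS T 0 A (St5.StIso.refl A) n).equiv Y).some
  let eB := fun n => ((St5.stIso_iter S hS T 1 B (St5.StIso.refl B) n).equiv Y).some
  let eC := fun n => ((St5.stIso_iter S hS T 2 Co (St5.stIso_rot T) n).equiv Y).some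
  refine ⟨fun n => (eB n).symm.toAddMonoidHom.comp
      ((St5.pre (St5.mp T (3 * n + 1)) Y).comp (eC n).toAddMonoidHom),
    fun n => (eA n).symm.toAddMonoidHom.comp
      ((St5.pre (St5.mp T (3 * n)) Y).comp (eB n).toAddMonoidHom),
    fun n => (eC n).symm.toAddMonoidHom.comp
      ((St5.pre (St5.mp T (3 * n + 2)) Y).comp (eA (n + 1)).toAddMonoidHom),
    (St5.conn hse Y).comp (eA 0).toAddMonoidHom,
    fun n => (Abelian.Ext.mk₀ p).precomp Y (zero_add (n + 1)),
    fun n => (Abelian.Ext.mk₀ i).precomp Y (zero_add (n + 1)),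
    fun n => hse.extClass.precomp Y (by omega),
    fun _ _ => rfl, fun _ _ => rfl, fun _ _ => rfl, ?_, ?_, ?_, ?_, ?_, ?_, ?_, ?_⟩
  · exact fun n => St5.exact_conj _ _ _ _ _ (St5.exact_mp T Y (3 * n + 1))
  · exact fun n => St5.exact_conj _ _ _ _ _ (St5.exact_mp T Y (3 * n))
  · exact fun n => St5.exact_conj _ _ _ _ _ (St5.exact_mp T Y (3 * n + 2))
  · exact St5.exact_conj (eB 0) (eA 0) (AddEquiv.refl _) (St5.pre i Y) (St5.conn hse Y)
      (St5.exact_conn₁ hse Y)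
  · exact St5.exact_conj (eA 0) (AddEquiv.refl _) (AddEquiv.refl _) (St5.conn hse Y) _
      (St5.exact_conn₂ hse Y)
  · intro n
    have := Abelian.Ext.contravariant_sequence_exact₂' hse Y (n + 1)
    rwa [ShortComplex.ab_exact_iff_function_exact] at this
  · intro n
    have := Abelian.Ext.contravariant_sequence_exact₁' hse Y (n + 1) (n + 2) (by omega)
    rwa [ShortComplex.ab_exact_iff_function_exact] at this
  · intro n
    have := Abelian.Ext.contravariant_sequence_exact₃' hse Y (n + 1) (n + 2) (by omega)
    rwa [ShortComplex.ab_exact_iff_function_exact] at this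
end

section
/- Let M = (Q, W, R) be a hereditary abelian model structure (Hovey triple) on an abelian category A. Given objects A, B and M-resolutions W_A and W_B, every morphism f : A → B extends to a chain map f_• : W_A → W_B compatible with the augmentations (ε_B f₀ = f ε_A and η_B f = f₋₁ η_A), and if f − g factors through an object of the core ω = Q ∩ W ∩ R, then any extension of f is chain homotopic to any extension of g. -/
open CategoryTheory CategoryTheory.Limits

universe w v u

variable {C : Type u} [Category.{v} C] [Abelian C]

/-- A hereditary abelian model structure (Hovey triple) `(𝒬, 𝒲, ℛ)` on an abelian
category: `𝒲` is thick, `(𝒬, 𝒲 ∩ ℛ)` and `(𝒬 ∩ 𝒲, ℛ)` are complete cotorsion pairs, and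
both cotorsion pairs are hereditary (`Extⁱ` vanishes for all `i ≥ 1`). -/
structure HoveyTriple (C : Type u) [Category.{v} C] [Abelian C] [HasExt.{w} C] where
  Q : C → Prop
  W : C → Prop
  R : C → Prop
  /-- `𝒲` is closed under retracts. -/
  thick_retract : ∀ ⦃X Y : C⦄, (∃ (s : Y ⟶ X) (r : X ⟶ Y), s ≫ r = 𝟙 Y) → W X → W Y
  /-- `𝒲` satisfies the two-out-of-three property on short exact sequences. -/
  thick_two_of_three : ∀ ⦃X Y Z : C⦄ (i : X ⟶ Y) (p : Y ⟶ Z) (w : i ≫ p = 0),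
    (ShortComplex.mk i p w).ShortExact →
      ((W X → W Y → W Z) ∧ (W X → W Z → W Y) ∧ (W Y → W Z → W X))
  /-- `Ext¹`-orthogonality of `𝒬` and `𝒲 ∩ ℛ`. -/
  orth₁ : ∀ ⦃X Y : C⦄, Q X → W Y → R Y → Subsingleton (Abelian.Ext X Y 1)
  orth₁_left : ∀ ⦃X : C⦄, (∀ Y : C, W Y → R Y → Subsingleton (Abelian.Ext X Y 1)) → Q X
  orth₁_right : ∀ ⦃Y : C⦄, (∀ X : C, Q X → Subsingleton (Abelian.Ext X Y 1)) → W Y ∧ R Y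
  /-- `Ext¹`-orthogonality of `𝒬 ∩ 𝒲` and `ℛ`. -/
  orth₂ : ∀ ⦃X Y : C⦄, Q X → W X → R Y → Subsingleton (Abelian.Ext X Y 1)
  orth₂_left : ∀ ⦃X : C⦄, (∀ Y : C, R Y → Subsingleton (Abelian.Ext X Y 1)) → Q X ∧ W X
  orth₂_right : ∀ ⦃Y : C⦄, (∀ X : C, Q X → W X → Subsingleton (Abelian.Ext X Y 1)) → R Y
  /-- the cotorsion pair `(𝒬, 𝒲 ∩ ℛ)` has enough projectives. -/
  complete₁_proj : ∀ A : C, ∃ (K E : C) (i : K ⟶ E) (p : E ⟶ A) (w : i ≫ p = 0),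
    Q E ∧ W K ∧ R K ∧ (ShortComplex.mk i p w).ShortExact
  /-- the cotorsion pair `(𝒬, 𝒲 ∩ ℛ)` has enough injectives. -/
  complete₁_inj : ∀ A : C, ∃ (E K : C) (i : A ⟶ E) (p : E ⟶ K) (w : i ≫ p = 0),
    W E ∧ R E ∧ Q K ∧ (ShortComplex.mk i p w).ShortExact
  /-- the cotorsion pair `(𝒬 ∩ 𝒲, ℛ)` has enough projectives. -/
  complete₂_proj : ∀ A : C, ∃ (K E : C) (i : K ⟶ E) (p : E ⟶ A) (w : i ≫ p = 0),
    Q E ∧ W E ∧ R K ∧ (ShortComplex.mk i p w).ShortExact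
  /-- the cotorsion pair `(𝒬 ∩ 𝒲, ℛ)` has enough injectives. -/
  complete₂_inj : ∀ A : C, ∃ (E K : C) (i : A ⟶ E) (p : E ⟶ K) (w : i ≫ p = 0),
    R E ∧ Q K ∧ W K ∧ (ShortComplex.mk i p w).ShortExact
  /-- heredity of `(𝒬, 𝒲 ∩ ℛ)`. -/
  hereditary₁ : ∀ ⦃X Y : C⦄ (i : ℕ), 1 ≤ i → Q X → W Y → R Y →
    Subsingleton (Abelian.Ext X Y i)
  /-- heredity of `(𝒬 ∩ 𝒲, ℛ)`. -/
  hereditary₂ : ∀ ⦃X Y : C⦄ (i : ℕ), 1 ≤ i → Q X → W X → R Y →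
    Subsingleton (Abelian.Ext X Y i)

variable [HasExt.{w} C]

/-- An `𝔐`-resolution of `A`: an everywhere-exact `ℤ`-indexed complex obtained by splicing
a resolution of `A` with components in `𝒬 ∩ 𝒲` and kernels in `ℛ` together with a
coresolution of `A` with components in `𝒲 ∩ ℛ` and cokernels in `𝒬`. -/
structure MResolution (M : HoveyTriple.{w} C) (A : C) where
  c : ChainComplex C ℤ
  ε : c.X 0 ⟶ A
  η : A ⟶ c.X (-1)
  epi : Epi ε
  mono : Mono η
  fac : c.d 0 (-1) = ε ≫ η
  comp_pos : ∀ n : ℤ, 0 ≤ n → M.Q (c.X n) ∧ M.W (c.X n)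
  comp_neg : ∀ n : ℤ, n < 0 → M.W (c.X n) ∧ M.R (c.X n)
  exact : ∀ n : ℤ, (ShortComplex.mk (c.d (n + 1) n) (c.d n (n - 1)) (c.d_comp_d _ _ _)).Exact
  ker_eps : M.R (kernel ε)
  ker_d : ∀ n : ℤ, 1 ≤ n → M.R (kernel (c.d n (n - 1)))
  cok_eta : M.Q (cokernel η)
  cok_d : ∀ n : ℤ, n ≤ -1 → M.Q (cokernel (c.d n (n - 1)))


lemma hov_lift_epi {P X Z : C} (f : X ⟶ Z) [Epi f] {K : C} (i : K ⟶ X) (w : i ≫ f = 0)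
    (hS : (ShortComplex.mk i f w).ShortExact)
    (h : Subsingleton (Abelian.Ext P K 1)) (u : P ⟶ Z) : ∃ v : P ⟶ X, v ≫ f = u := by
  obtain ⟨x, hx⟩ := Abelian.Ext.covariant_sequence_exact₃ P hS (Abelian.Ext.mk₀ u) (n₁ := 1)
    (by simp) (h.elim _ _)
  obtain ⟨v, rfl⟩ := (Abelian.Ext.mk₀_bijective _ _).2 x
  refine ⟨v, (Abelian.Ext.mk₀_bijective _ _).1 ?_⟩
  rw [← hx, Abelian.Ext.mk₀_comp_mk₀]

lemma hov_ext_mono {I X Y : C} (g : X ⟶ Y) [Mono g] {K : C} (p : Y ⟶ K) (w : g ≫ p = 0)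
    (hS : (ShortComplex.mk g p w).ShortExact)
    (h : Subsingleton (Abelian.Ext K I 1)) (u : X ⟶ I) : ∃ v : Y ⟶ I, g ≫ v = u := by
  obtain ⟨x, hx⟩ := Abelian.Ext.contravariant_sequence_exact₁ hS I (Abelian.Ext.mk₀ u) (n₁ := 1)
    (by simp) (h.elim _ _)
  obtain ⟨v, rfl⟩ := (Abelian.Ext.mk₀_bijective _ _).2 x
  refine ⟨v, (Abelian.Ext.mk₀_bijective _ _).1 ?_⟩
  rw [← hx, Abelian.Ext.mk₀_comp_mk₀]

lemma hov_lift {P X Y Z : C} (f : X ⟶ Y) (g : Y ⟶ Z) (w : f ≫ g = 0)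
    (hE : (ShortComplex.mk f g w).Exact)
    (h : Subsingleton (Abelian.Ext P (kernel f) 1)) (u : P ⟶ Y) (hu : u ≫ g = 0) :
    ∃ v : P ⟶ X, v ≫ f = u := by
  have : Epi (kernel.lift g f w) := (ShortComplex.exact_iff_epi_kernel_lift _).1 hE
  have w' : kernel.ι f ≫ kernel.lift g f w = 0 := by
    rw [← cancel_mono (kernel.ι g)]; simp
  obtain ⟨v, hv⟩ := hov_lift_epi (kernel.lift g f w) (kernel.ι f) w'
    { exact := by
        apply ShortComplex.exact_of_f_is_kernel
        refine KernelFork.IsLimit.ofι' _ _ fun {A} k hk => ⟨kernel.lift f k (by simpa using hk =≫ kernel.ι g), kernel.lift_ι _ _ _⟩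
      mono_f := by dsimp; infer_instance
      epi_g := this } h (kernel.lift g u hu)
  exact ⟨v, by simpa using hv =≫ kernel.ι g⟩

lemma hov_ext {I X Y Z : C} (f : X ⟶ Y) (g : Y ⟶ Z) (w : f ≫ g = 0)
    (hE : (ShortComplex.mk f g w).Exact)
    (h : Subsingleton (Abelian.Ext (cokernel g) I 1)) (u : Y ⟶ I) (hu : f ≫ u = 0) :
    ∃ v : Z ⟶ I, g ≫ v = u := by
  have : Mono (cokernel.desc f g w) := (ShortComplex.exact_iff_mono_cokernel_desc _).1 hE
  have w' : cokernel.desc f g w ≫ cokernel.π g = 0 := by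
    rw [← cancel_epi (cokernel.π f)]; simp
  obtain ⟨v, hv⟩ := hov_ext_mono (cokernel.desc f g w) (cokernel.π g) w'
    { exact := by
        apply ShortComplex.exact_of_g_is_cokernel
        refine CokernelCofork.IsColimit.ofπ' _ _ fun {A} k hk => ⟨cokernel.desc g k (by simpa using cokernel.π f ≫= hk),
          cokernel.π_desc _ _ _⟩
      mono_f := this
      epi_g := by dsimp; infer_instance } h (cokernel.desc f u hu)
  exact ⟨v, by simpa using cokernel.π f ≫= hv⟩

lemma HoveyTriple.Q_iso (M : HoveyTriple.{w} C) {X Y : C} (e : X ≅ Y) (h : M.Q X) : M.Q Y := by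
  refine M.orth₁_left fun Z hW hR => ⟨fun a b => ?_⟩
  have := M.orth₁ h hW hR
  have h' : (Abelian.Ext.mk₀ e.hom).comp a (zero_add 1) =
    (Abelian.Ext.mk₀ e.hom).comp b (zero_add 1) := Subsingleton.elim _ _
  have h2 := congrArg (fun x => (Abelian.Ext.mk₀ e.inv).comp x (zero_add 1)) h'
  simpa using h2

lemma int_choice {T : ℤ → Type*} (r : ∀ i j, T i → T j → Prop) (k : ℤ) (t0 : T k)
    (up : ∀ n, k ≤ n → ∀ t : T n, ∃ t' : T (n + 1), r (n + 1) n t' t)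
    (down : ∀ n, n ≤ k → ∀ t : T n, ∃ t' : T (n - 1), r n (n - 1) t t') :
    ∃ t : ∀ n, T n, t k = t0 ∧ ∀ i j, j + 1 = i → r i j (t i) (t j) := by
  choose U hU using up
  choose D hD using down
  refine ⟨fun n => Int.inductionOn' n k t0 U D, Int.inductionOn'_self .., ?_⟩
  rintro _ j rfl
  rcases le_or_gt k j with h | h
  · dsimp only
    rw [Int.inductionOn'_add_one (hz := h)]
    exact hU _ _ _
  · obtain ⟨m, rfl⟩ : ∃ m, j = m - 1 := ⟨j + 1, by simp⟩
    have hm : m ≤ k := by omega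
    dsimp only
    rw [Int.inductionOn'_sub_one (hz := hm)]
    have key : ∀ i, i = m → r i (m - 1) (Int.inductionOn' i k t0 U D)
        (D m hm (Int.inductionOn' m k t0 U D)) := by
      rintro _ rfl
      exact hD _ _ _
    exact key _ (by simp)

namespace MResolution
variable {M : HoveyTriple.{w} C} {A : C} (WA : MResolution M A)

lemma exact' (i j k : ℤ) (h : j + 1 = i) (h' : k + 1 = j) :
    (ShortComplex.mk (WA.c.d i j) (WA.c.d j k) (WA.c.d_comp_d _ _ _)).Exact := by
  obtain rfl : k = j - 1 := by omega
  subst h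
  exact WA.exact j

lemma ker_d' (i j : ℤ) (h : j + 1 = i) (h' : 0 ≤ j) : M.R (kernel (WA.c.d i j)) := by
  obtain rfl : j = i - 1 := by omega
  exact WA.ker_d i (by omega)

lemma cok_d' (i j : ℤ) (h : j + 1 = i) (h' : i ≤ 0) : M.Q (cokernel (WA.c.d i j)) := by
  obtain rfl : j = i - 1 := by omega
  rcases eq_or_ne i 0 with rfl | h0
  · change M.Q (cokernel (WA.c.d 0 (-1)))
    have := WA.epi
    rw [WA.fac]
    exact M.Q_iso (cokernelEpiComp WA.ε WA.η).symm WA.cok_eta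
  · exact WA.cok_d i (by omega)

lemma d_eps (i : ℤ) : WA.c.d i 0 ≫ WA.ε = 0 := by
  have := WA.mono
  rw [← cancel_mono WA.η]
  simp [← WA.fac]

/-- Lifting against the resolution part. -/
lemma lift (P : C) (hP : M.Q P) (hP' : M.W P) (i j k : ℤ) (h : j + 1 = i) (h' : k + 1 = j)
    (hj : 0 ≤ j) (u : P ⟶ WA.c.X j) (hu : u ≫ WA.c.d j k = 0) :
    ∃ v : P ⟶ WA.c.X i, v ≫ WA.c.d i j = u :=
  hov_lift _ _ _ (WA.exact' i j k h h') (M.orth₂ hP hP' (WA.ker_d' i j h hj)) u hu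

/-- Extending along the coresolution part. -/
lemma extend (I : C) (hI : M.W I) (hI' : M.R I) (i j k : ℤ) (h : j + 1 = i) (h' : k + 1 = j)
    (hj : j ≤ 0) (u : WA.c.X j ⟶ I) (hu : WA.c.d i j ≫ u = 0) :
    ∃ v : WA.c.X k ⟶ I, WA.c.d j k ≫ v = u :=
  hov_ext _ _ _ (WA.exact' i j k h h') (M.orth₁ (WA.cok_d' j k h' hj) hI hI') u hu

lemma lift_eps (P : C) (hP : M.Q P) (hP' : M.W P) (u : P ⟶ A) : ∃ v, v ≫ WA.ε = u := by
  have := WA.epi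
  exact hov_lift_epi WA.ε (kernel.ι WA.ε) (by simp)
    { exact := ShortComplex.exact_of_f_is_kernel _ (kernelIsKernel _)
      mono_f := by dsimp; infer_instance
      epi_g := this } (M.orth₂ hP hP' WA.ker_eps) u

lemma extend_eta (I : C) (hI : M.W I) (hI' : M.R I) (u : A ⟶ I) : ∃ v, WA.η ≫ v = u := by
  have := WA.mono
  exact hov_ext_mono WA.η (cokernel.π WA.η) (by simp)
    { exact := ShortComplex.exact_of_g_is_cokernel _ (cokernelIsCokernel _)
      mono_f := this
      epi_g := by dsimp; infer_instance } (M.orth₁ WA.cok_eta hI hI') u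

end MResolution

lemma hov_exists (M : HoveyTriple.{w} C) (A B : C)
    (WA : MResolution M A) (WB : MResolution M B) (f : A ⟶ B) : ∃ φ : WA.c ⟶ WB.c,
        φ.f 0 ≫ WB.ε = WA.ε ≫ f ∧ f ≫ WB.η = WA.η ≫ φ.f (-1) := by
  obtain ⟨φ₀, h₀⟩ := WB.lift_eps _ (WA.comp_pos 0 le_rfl).1 (WA.comp_pos 0 le_rfl).2 (WA.ε ≫ f)
  obtain ⟨t, ht0, ht⟩ := int_choice
    (T := fun n => {s : WA.c.X n ⟶ WB.c.X n // ∀ i j, WA.c.d i n ≫ s ≫ WB.c.d n j = 0})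
    (fun i j s t => s.1 ≫ WB.c.d i j = WA.c.d i j ≫ t.1) 0
    ⟨φ₀, fun i j => by
      by_cases hj : j = -1
      · subst hj
        rw [WB.fac, reassoc_of% h₀, ← Category.assoc, WA.d_eps, zero_comp]
      · rw [WB.c.shape, comp_zero, comp_zero]
        simp; omega⟩
    (by
      rintro n hn ⟨s, hs⟩
      obtain ⟨v, hv⟩ := WB.lift _ (WA.comp_pos (n+1) (by omega)).1 (WA.comp_pos (n+1) (by omega)).2
        (n+1) n (n-1) rfl (by simp) hn (WA.c.d (n+1) n ≫ s) (by simp [hs])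
      refine ⟨⟨v, fun i j => ?_⟩, hv⟩
      by_cases hj : j = n
      · subst hj; simp [hv]
      · rw [WB.c.shape, comp_zero, comp_zero]
        simp; omega)
    (by
      rintro n hn ⟨s, hs⟩
      obtain ⟨v, hv⟩ := WA.extend _ (WB.comp_neg (n-1) (by omega)).1 (WB.comp_neg (n-1) (by omega)).2
        (n+1) n (n-1) rfl (by simp) hn (s ≫ WB.c.d n (n-1)) (by simp [hs])
      refine ⟨⟨v, fun i j => ?_⟩, hv.symm⟩
      by_cases hi : i = n
      · subst hi; simp [reassoc_of% hv]
      · rw [WA.c.shape, zero_comp]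
        simp; omega)
  refine ⟨{ f := fun n => (t n).1, comm' := fun i j hij => ht i j hij }, ?_, ?_⟩
  · simpa [ht0] using h₀
  · have := WA.epi
    have h := ht 0 (-1) (by simp)
    rw [ht0] at h
    dsimp only at h
    rw [WA.fac, WB.fac, reassoc_of% h₀] at h
    rw [← cancel_epi WA.ε]
    simpa using h

/-- The degreewise morphism concentrated in one target degree. -/
noncomputable def hovSingle {P : C} {Y : ℤ → C} (k : ℤ) (v : P ⟶ Y k) (j : ℤ) : P ⟶ Y j :=
  if h : k = j then v ≫ eqToHom (by rw [h]) else 0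

lemma hovSingle_self {P : C} {Y : ℤ → C} (k : ℤ) (v : P ⟶ Y k) : hovSingle k v k = v := by
  simp [hovSingle]

lemma hovSingle_ne {P : C} {Y : ℤ → C} (k : ℤ) (v : P ⟶ Y k) (j : ℤ) (h : k ≠ j) :
    hovSingle k v j = 0 := by
  simp [hovSingle, h]

lemma hov_homotopy (M : HoveyTriple.{w} C) (A B : C)
    (WA : MResolution M A) (WB : MResolution M B) (θ : WA.c ⟶ WB.c) (h : A ⟶ B)
    (hη : h ≫ WB.η = WA.η ≫ θ.f (-1)) (s₀ : WA.c.X (-1) ⟶ WB.c.X 0)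
    (hs₀ : WA.η ≫ s₀ ≫ WB.ε = h) : Nonempty (Homotopy θ 0) := by
  obtain ⟨t, -, ht⟩ := int_choice
    (T := fun n => {s : ∀ j, WA.c.X n ⟶ WB.c.X j // (∀ j, n + 1 ≠ j → s j = 0) ∧
      ∀ i j, n + 1 = j → WA.c.d i n ≫ s j ≫ WB.c.d j n = WA.c.d i n ≫ θ.f n})
    (fun i j s t => ∀ l, i + 1 = l → s.1 l ≫ WB.c.d l i = θ.f i - WA.c.d i j ≫ t.1 i) (-1)
    ⟨hovSingle 0 s₀, fun j hj => hovSingle_ne _ _ _ (by simpa using hj), fun i j hj => by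
      obtain rfl : j = 0 := by omega
      rw [hovSingle_self]
      by_cases hi : i = 0
      · subst hi
        rw [WA.fac, WB.fac, Category.assoc, Category.assoc, ← hη, ← hs₀]
        simp
      · rw [WA.c.shape, zero_comp, zero_comp]
        simp; omega⟩
    (by
      rintro n hn ⟨s, hs, hs'⟩
      obtain ⟨v, hv⟩ := WB.lift _ (WA.comp_pos (n+1) (by omega)).1 (WA.comp_pos (n+1) (by omega)).2
        (n+1+1) (n+1) n rfl rfl (by omega) (θ.f (n+1) - WA.c.d (n+1) n ≫ s (n+1))
        (by simp [hs' _ _ rfl])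
      refine ⟨⟨hovSingle (n+1+1) v, fun j hj => hovSingle_ne _ _ _ hj, ?_⟩, ?_⟩
      · rintro i _ rfl
        rw [hovSingle_self, hv]; simp
      · rintro _ rfl
        simp only [hovSingle_self, hv])
    (by
      rintro n hn ⟨s, hs, hs'⟩
      obtain ⟨v, hv⟩ := WA.extend _ (WB.comp_neg n (by omega)).1 (WB.comp_neg n (by omega)).2
        (n+1) n (n-1) rfl (by simp) (by omega) (θ.f n - s (n+1) ≫ WB.c.d (n+1) n)
        (by simp [hs' _ _ rfl])
      refine ⟨⟨hovSingle n v, fun j hj => hovSingle_ne _ _ _ (by omega), ?_⟩, ?_⟩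
      · intro i j hj
        obtain rfl : j = n := by omega
        rw [hovSingle_self]
        by_cases hi : i = j
        · subst hi; rw [reassoc_of% hv]; simp
        · rw [WA.c.shape, zero_comp, zero_comp]
          simp; omega
      · rintro _ rfl
        simp only [hovSingle_self, hv]
        simp)
  refine ⟨{ hom := fun i j => (t i).1 j, zero := fun i j hij => (t i).2.1 j hij, comm := ?_ }⟩
  intro i
  have hr : (ComplexShape.down ℤ).Rel i (i - 1) := by simp
  have hr' : (ComplexShape.down ℤ).Rel (i + 1) i := by simp
  rw [dNext_eq _ hr, prevD_eq _ hr', ht i (i-1) (by simp) (i+1) rfl]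
  simp

/-- Comparison theorem: every morphism `f : A ⟶ B` extends to a chain map
between `𝔐`-resolutions compatibly with the augmentations, and if `g - f` factors through an
object of the core `ω = 𝒬 ∩ 𝒲 ∩ ℛ` then any extension of `f` is chain homotopic to any
extension of `g`. -/
theorem statement6 (M : HoveyTriple.{w} C) (A B : C)
    (WA : MResolution M A) (WB : MResolution M B) :
    (∀ f : A ⟶ B, ∃ φ : WA.c ⟶ WB.c,
        φ.f 0 ≫ WB.ε = WA.ε ≫ f ∧ f ≫ WB.η = WA.η ≫ φ.f (-1)) ∧
    (∀ f g : A ⟶ B,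
        (∃ (ω : C), (M.Q ω ∧ M.W ω ∧ M.R ω) ∧ ∃ (a : A ⟶ ω) (b : ω ⟶ B), g - f = a ≫ b) →
        ∀ φ ψ : WA.c ⟶ WB.c,
          (φ.f 0 ≫ WB.ε = WA.ε ≫ f ∧ f ≫ WB.η = WA.η ≫ φ.f (-1)) →
          (ψ.f 0 ≫ WB.ε = WA.ε ≫ g ∧ g ≫ WB.η = WA.η ≫ ψ.f (-1)) →
          Nonempty (Homotopy φ ψ)) := by
  refine ⟨hov_exists M A B WA WB, ?_⟩
  rintro f g ⟨ω, ⟨hQ, hW, hR⟩, a, b, hab⟩ φ ψ ⟨_, h2⟩ ⟨_, h4⟩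
  obtain ⟨a', ha'⟩ := WA.extend_eta ω hW hR a
  obtain ⟨b', hb'⟩ := WB.lift_eps ω hQ hW b
  obtain ⟨H⟩ := hov_homotopy M A B WA WB (ψ - φ) (g - f) (by simp [h2, h4]) (a' ≫ b')
    (by rw [Category.assoc, hb', reassoc_of% ha', hab])
  exact ⟨(Homotopy.equivSubZero.symm H).symm⟩
end

section
/- Let M = (Q, W, R) be a hereditary abelian model structure on an abelian category A with core ω = Q∩W∩R. Let 0 → QΩA → QW_A → QA → 0 be a short exact sequence with QΩA, QA ∈ Q and QW_A ∈ Q∩W, and let RB ∈ R. Then the connecting map δ : Hom_A(QΩA, RB) → Ext¹_A(QA, RB) is surjective with kernel exactly the morphisms factoring through an object of ω; hence it induces an isomorphism Hom_A(QΩA, RB)/∼ω ≅ Ext¹_A(QA, RB). -/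
open CategoryTheory CategoryTheory.Limits

universe w v u

variable {C : Type u} [Category.{v} C] [Abelian C]

variable [HasExt.{w} C]

/-- The subgroup (generated by) the morphisms factoring through an object of the core
`ω = 𝒬 ∩ 𝒲 ∩ ℛ`. -/
def omegaFactorSub (M : HoveyTriple.{w} C) (X Y : C) : AddSubgroup (X ⟶ Y) :=
  AddSubgroup.closure
    {f : X ⟶ Y | ∃ ω : C, (M.Q ω ∧ M.W ω ∧ M.R ω) ∧ ∃ (a : X ⟶ ω) (b : ω ⟶ Y), f = a ≫ b}

/-- for a short exact sequence `0 → QΩA → QW_A → QA → 0` with `QΩA, QA`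
cofibrant and `QW_A` trivially cofibrant, and `RB` fibrant, the connecting map
`δ : Hom(QΩA, RB) → Ext¹(QA, RB)` (pushout of the sequence along `f`) is surjective and its
kernel is exactly the set of morphisms factoring through an object of the core `ω`; hence it
induces an isomorphism `Hom(QΩA, RB)/∼ω ≅ Ext¹(QA, RB)`. -/
theorem statement14 (M : HoveyTriple.{w} C) (QΩA QWA QA RB : C)
    (hQΩA : M.Q QΩA) (hQWA : M.Q QWA ∧ M.W QWA) (hQA : M.Q QA) (hRB : M.R RB)
    (i : QΩA ⟶ QWA) (p : QWA ⟶ QA) (wip : i ≫ p = 0)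
    (hse : (ShortComplex.mk i p wip).ShortExact) :
    (∀ e : Abelian.Ext QA RB 1, ∃ f : QΩA ⟶ RB,
        hse.extClass.comp (Abelian.Ext.mk₀ f) (add_zero 1) = e) ∧
    (∀ f : QΩA ⟶ RB,
        hse.extClass.comp (Abelian.Ext.mk₀ f) (add_zero 1) = 0 ↔
          ∃ ω : C, (M.Q ω ∧ M.W ω ∧ M.R ω) ∧ ∃ (a : QΩA ⟶ ω) (b : ω ⟶ RB), f = a ≫ b) ∧
    Nonempty (((QΩA ⟶ RB) ⧸ omegaFactorSub M QΩA RB) ≃+ Abelian.Ext QA RB 1) := by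
  have hsurj : ∀ e : Abelian.Ext QA RB 1, ∃ f : QΩA ⟶ RB,
      hse.extClass.comp (Abelian.Ext.mk₀ f) (add_zero 1) = e := by
    intro e
    have := M.orth₂ hQWA.1 hQWA.2 hRB
    obtain ⟨x, hx⟩ := Abelian.Ext.contravariant_sequence_exact₃ hse RB e
      (Subsingleton.elim (α := Abelian.Ext QWA RB 1) _ _) (add_zero 1)
    obtain ⟨f, rfl⟩ := (Abelian.Ext.mk₀_bijective QΩA RB).2 x
    exact ⟨f, hx⟩
  have hker : ∀ f : QΩA ⟶ RB,
      hse.extClass.comp (Abelian.Ext.mk₀ f) (add_zero 1) = 0 ↔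
        ∃ ω : C, (M.Q ω ∧ M.W ω ∧ M.R ω) ∧ ∃ (a : QΩA ⟶ ω) (b : ω ⟶ RB), f = a ≫ b := by
    intro f
    constructor
    · intro hf
      obtain ⟨x, hx⟩ := Abelian.Ext.contravariant_sequence_exact₁ hse RB _ (add_zero 1) hf
      obtain ⟨g, rfl⟩ := (Abelian.Ext.mk₀_bijective QWA RB).2 x
      have hx' : i ≫ g = f :=
        (Abelian.Ext.mk₀_bijective QΩA RB).1 ((Abelian.Ext.mk₀_comp_mk₀ i g).symm.trans hx)
      obtain ⟨E, K, j, q, w, hE, hKQ, hKW, hS⟩ := M.complete₂_inj QWA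
      have hEQW : M.Q E ∧ M.W E := by
        refine M.orth₂_left fun Y hY => ⟨fun x y => ?_⟩
        have h1 := M.orth₂ hQWA.1 hQWA.2 hY
        have h3 := M.orth₂ hKQ hKW hY
        have key : ∀ z : Abelian.Ext E Y 1, z = 0 := by
          intro z
          obtain ⟨t, ht⟩ := Abelian.Ext.contravariant_sequence_exact₂ hS Y z
            (Subsingleton.elim (α := Abelian.Ext QWA Y 1) _ _)
          rw [← ht, Subsingleton.elim (α := Abelian.Ext K Y 1) t 0]
          apply Abelian.Ext.comp_zero
        rw [key x, key y]
      have h3 := M.orth₂ hKQ hKW hRB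
      obtain ⟨y, hy⟩ := Abelian.Ext.contravariant_sequence_exact₁ hS RB
        (Abelian.Ext.mk₀ g) (add_zero 1) (Subsingleton.elim (α := Abelian.Ext K RB 1) _ _)
      obtain ⟨b, rfl⟩ := (Abelian.Ext.mk₀_bijective E RB).2 y
      have hy' : j ≫ b = g :=
        (Abelian.Ext.mk₀_bijective QWA RB).1 ((Abelian.Ext.mk₀_comp_mk₀ j b).symm.trans hy)
      exact ⟨E, ⟨hEQW.1, hEQW.2, hE⟩, i ≫ j, b, by rw [Category.assoc, hy', hx']⟩
    · rintro ⟨ω, ⟨_, hW, hR⟩, a, b, rfl⟩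
      have := M.orth₁ hQA hW hR
      rw [← Abelian.Ext.mk₀_comp_mk₀, ← Abelian.Ext.comp_assoc_of_second_deg_zero,
        Subsingleton.elim (α := Abelian.Ext QA ω 1)
          (hse.extClass.comp (Abelian.Ext.mk₀ a) (add_zero 1)) 0]
      apply Abelian.Ext.zero_comp
  refine ⟨hsurj, hker, ?_⟩
  let δ : (QΩA ⟶ RB) →+ Abelian.Ext QA RB 1 :=
    AddMonoidHom.mk' (fun f => hse.extClass.comp (Abelian.Ext.mk₀ f) (add_zero 1))
      (fun f g => by rw [Abelian.Ext.mk₀_add, Abelian.Ext.comp_add])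
  have hδ : omegaFactorSub M QΩA RB = δ.ker := by
    have hset : {f : QΩA ⟶ RB | ∃ ω : C, (M.Q ω ∧ M.W ω ∧ M.R ω) ∧
        ∃ (a : QΩA ⟶ ω) (b : ω ⟶ RB), f = a ≫ b} = (δ.ker : Set (QΩA ⟶ RB)) := by
      ext f
      exact (hker f).symm
    unfold omegaFactorSub
    rw [hset, AddSubgroup.closure_eq]
  exact ⟨(QuotientAddGroup.quotientAddEquivOfEq hδ).trans
    (QuotientAddGroup.quotientKerEquivOfSurjective δ hsurj)⟩
end

section
/- Let M = (Q, W, R) be a hereditary abelian model structure on an abelian category A. For any objects A, B and any integer n ≥ 1 there is a natural isomorphism Ho(M)(ΩⁿA, B) ≅ Extⁿ_A(QA, RB) ≅ Ho(M)(A, ΣⁿB), where Ω and Σ are the loop and suspension functors on the homotopy category, QA is a cofibrant replacement of A, and RB is a fibrant replacement of B. -/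
open CategoryTheory CategoryTheory.Limits

universe w v u

variable {C : Type u} [Category.{v} C] [Abelian C]

variable [HasExt.{w} C]

/-- `QA` is a cofibrant replacement of `A`: there is a short exact sequence
`0 → K → QA → A → 0` with `QA ∈ 𝒬` and `K ∈ 𝒲 ∩ ℛ`. -/
def IsCofRep (M : HoveyTriple.{w} C) (QA A : C) : Prop :=
  M.Q QA ∧ ∃ (K : C) (i : K ⟶ QA) (p : QA ⟶ A) (wip : i ≫ p = 0),
    M.W K ∧ M.R K ∧ (ShortComplex.mk i p wip).ShortExact

/-- `RA` is a fibrant replacement of `A`: there is a short exact sequence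
`0 → A → RA → Z → 0` with `RA ∈ ℛ` and `Z ∈ 𝒬 ∩ 𝒲`. -/
def IsFibRep (M : HoveyTriple.{w} C) (RA A : C) : Prop :=
  M.R RA ∧ ∃ (Z : C) (i : A ⟶ RA) (p : RA ⟶ Z) (wip : i ≫ p = 0),
    M.Q Z ∧ M.W Z ∧ (ShortComplex.mk i p wip).ShortExact

/-- `SX` is a suspension `ΣX` of `X`: there is a short exact sequence `0 → X → W → SX → 0`
with `W ∈ 𝒲`. -/
def IsSusp (M : HoveyTriple.{w} C) (X SX : C) : Prop :=
  ∃ (Wo : C) (i : X ⟶ Wo) (p : Wo ⟶ SX) (wip : i ≫ p = 0),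
    M.W Wo ∧ (ShortComplex.mk i p wip).ShortExact

/-- `OX` is a loop `ΩX` of `X`: there is a short exact sequence `0 → OX → W → X → 0`
with `W ∈ 𝒲`. -/
def IsLoop (M : HoveyTriple.{w} C) (OX X : C) : Prop :=
  ∃ (Wo : C) (i : OX ⟶ Wo) (p : Wo ⟶ X) (wip : i ≫ p = 0),
    M.W Wo ∧ (ShortComplex.mk i p wip).ShortExact

/-- The hom-group `Ho(𝔐)(A, B) = Hom(RQA, RQB)/∼ω` of the homotopy category, computed from
given bifibrant replacements. -/
def hoHom (M : HoveyTriple.{w} C) (X Y : C) :=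
  (X ⟶ Y) ⧸ omegaFactorSub M X Y

noncomputable instance (M : HoveyTriple.{w} C) (X Y : C) : AddCommGroup (hoHom M X Y) := by
  unfold hoHom; infer_instance

section Aux

set_option linter.unusedSectionVars false
set_option linter.unusedSimpArgs false

open Abelian

/-- Short exact sequence, as a predicate on two maps. -/
def SES16 {X Y Z : C} (i : X ⟶ Y) (p : Y ⟶ Z) : Prop :=
  ∃ w : i ≫ p = 0, (ShortComplex.mk i p w).ShortExact

lemma SES16.of_lift {X Y Z : C} (i : X ⟶ Y) (p : Y ⟶ Z) [Mono i] [Epi p] (w : i ≫ p = 0)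
    (h : ∀ (T : C) (t : T ⟶ Y), t ≫ p = 0 → ∃ l : T ⟶ X, l ≫ i = t) : SES16 i p := by
  refine ⟨w, ?_⟩
  have hex : (ShortComplex.mk i p w).Exact := by
    apply ShortComplex.exact_of_f_is_kernel
    exact KernelFork.IsLimit.ofι' _ _ (fun {A} k hk => ⟨(h A k hk).choose, (h A k hk).choose_spec⟩)
  exact { exact := hex, mono_f := ‹_›, epi_g := ‹_› }

lemma SES16.of_desc {X Y Z : C} (i : X ⟶ Y) (p : Y ⟶ Z) [Mono i] [Epi p] (w : i ≫ p = 0)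
    (h : ∀ (T : C) (t : Y ⟶ T), i ≫ t = 0 → ∃ l : Z ⟶ T, p ≫ l = t) : SES16 i p := by
  refine ⟨w, ?_⟩
  have hex : (ShortComplex.mk i p w).Exact := by
    apply ShortComplex.exact_of_g_is_cokernel
    exact CokernelCofork.IsColimit.ofπ' _ _
      (fun {A} k hk => ⟨(h A k hk).choose, (h A k hk).choose_spec⟩)
  exact { exact := hex, mono_f := ‹_›, epi_g := ‹_› }

lemma SES16.zero {X Y Z : C} {i : X ⟶ Y} {p : Y ⟶ Z} (h : SES16 i p) : i ≫ p = 0 :=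
  h.choose

lemma SES16.mono {X Y Z : C} {i : X ⟶ Y} {p : Y ⟶ Z} (h : SES16 i p) : Mono i :=
  h.choose_spec.mono_f

lemma SES16.epi {X Y Z : C} {i : X ⟶ Y} {p : Y ⟶ Z} (h : SES16 i p) : Epi p :=
  h.choose_spec.epi_g

lemma SES16.lift {X Y Z : C} {i : X ⟶ Y} {p : Y ⟶ Z} (h : SES16 i p) {T : C} (t : T ⟶ Y)
    (ht : t ≫ p = 0) : ∃ l : T ⟶ X, l ≫ i = t := by
  obtain ⟨w, hs⟩ := h
  have := hs.mono_f
  exact ⟨hs.exact.lift t ht, hs.exact.lift_f t ht⟩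

lemma SES16.desc {X Y Z : C} {i : X ⟶ Y} {p : Y ⟶ Z} (h : SES16 i p) {T : C} (t : Y ⟶ T)
    (ht : i ≫ t = 0) : ∃ l : Z ⟶ T, p ≫ l = t := by
  obtain ⟨w, hs⟩ := h
  have := hs.epi_g
  exact ⟨hs.exact.desc t ht, hs.exact.g_desc t ht⟩

lemma SES16.pullback {K E B B' : C} {i : K ⟶ E} {p : E ⟶ B} (h : SES16 i p) (f : B' ⟶ B) :
    SES16 (pullback.lift i 0 (by rw [h.zero, zero_comp]) : K ⟶ pullback p f)
      (pullback.snd p f) := by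
  have := h.mono
  have := h.epi
  have hm : Mono (pullback.lift i 0 (by rw [h.zero, zero_comp]) : K ⟶ Limits.pullback p f) := by
    have : Mono ((pullback.lift i 0 (by rw [h.zero, zero_comp]) : K ⟶ Limits.pullback p f) ≫
        pullback.fst p f) := by
      rw [pullback.lift_fst]; infer_instance
    exact mono_of_mono _ (pullback.fst p f)
  refine SES16.of_lift _ _ (by simp [pullback.lift_fst, pullback.lift_snd, pushout.inl_desc, pushout.inr_desc, pullback.lift_fst_assoc, pullback.lift_snd_assoc, pushout.inl_desc_assoc, pushout.inr_desc_assoc]) ?_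
  intro T t ht
  obtain ⟨l, hl⟩ := h.lift (t ≫ pullback.fst p f) (by
    rw [Category.assoc, pullback.condition, reassoc_of% ht, zero_comp])
  refine ⟨l, ?_⟩
  apply pullback.hom_ext
  · simpa [pullback.lift_fst, pullback.lift_snd, pushout.inl_desc, pushout.inr_desc, pullback.lift_fst_assoc, pullback.lift_snd_assoc, pushout.inl_desc_assoc, pushout.inr_desc_assoc] using hl
  · simpa [pullback.lift_fst, pullback.lift_snd, pushout.inl_desc, pushout.inr_desc, pullback.lift_fst_assoc, pullback.lift_snd_assoc, pushout.inl_desc_assoc, pushout.inr_desc_assoc] using ht.symm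

lemma SES16.pushout {A E D A' : C} {i : A ⟶ E} {p : E ⟶ D} (h : SES16 i p) (f : A ⟶ A') :
    SES16 (pushout.inr i f)
      (pushout.desc p 0 (by rw [h.zero, comp_zero]) : pushout i f ⟶ D) := by
  have := h.mono
  have := h.epi
  have hm : Epi (pushout.desc p 0 (by rw [h.zero, comp_zero]) : Limits.pushout i f ⟶ D) := by
    have : Epi (pushout.inl i f ≫
        (pushout.desc p 0 (by rw [h.zero, comp_zero]) : Limits.pushout i f ⟶ D)) := by
      rw [pushout.inl_desc]; infer_instance
    exact epi_of_epi (pushout.inl i f) _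
  refine SES16.of_desc _ _ (by simp [pullback.lift_fst, pullback.lift_snd, pushout.inl_desc, pushout.inr_desc, pullback.lift_fst_assoc, pullback.lift_snd_assoc, pushout.inl_desc_assoc, pushout.inr_desc_assoc]) ?_
  intro T t ht
  obtain ⟨l, hl⟩ := h.desc (pushout.inl i f ≫ t) (by
    rw [← Category.assoc, pushout.condition, Category.assoc, ht, comp_zero])
  refine ⟨l, ?_⟩
  apply pushout.hom_ext
  · simpa [pullback.lift_fst, pullback.lift_snd, pushout.inl_desc, pushout.inr_desc, pullback.lift_fst_assoc, pullback.lift_snd_assoc, pushout.inl_desc_assoc, pushout.inr_desc_assoc] using hl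
  · simpa [pullback.lift_fst, pullback.lift_snd, pushout.inl_desc, pushout.inr_desc, pullback.lift_fst_assoc, pullback.lift_snd_assoc, pushout.inl_desc_assoc, pushout.inr_desc_assoc] using ht.symm

/-- Existence of a short exact sequence. -/
def HasSES16 (X Y Z : C) : Prop := ∃ (i : X ⟶ Y) (p : Y ⟶ Z), SES16 i p

lemma HasSES16.pb_epi {K E B L B' : C} (h₁ : HasSES16 K E B) (h₂ : HasSES16 L B' B) :
    ∃ E', HasSES16 K E' B' ∧ HasSES16 L E' E := by
  obtain ⟨i, p, h₁⟩ := h₁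
  obtain ⟨j, q, h₂⟩ := h₂
  refine ⟨pullback p q, ⟨_, _, h₁.pullback q⟩, ?_⟩
  have := h₂.mono
  have := h₂.epi
  have hw : (0 : L ⟶ E) ≫ p = j ≫ q := by rw [h₂.zero, zero_comp]
  have hm : Mono (pullback.lift 0 j hw) := by
    have : Mono (pullback.lift 0 j hw ≫ pullback.snd p q) := by
      rw [pullback.lift_snd]; infer_instance
    exact mono_of_mono _ (pullback.snd p q)
  refine ⟨pullback.lift 0 j hw, pullback.fst p q, SES16.of_lift _ _ (by simp [pullback.lift_fst, pullback.lift_snd, pushout.inl_desc, pushout.inr_desc, pullback.lift_fst_assoc, pullback.lift_snd_assoc, pushout.inl_desc_assoc, pushout.inr_desc_assoc]) ?_⟩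
  intro T t ht
  obtain ⟨l, hl⟩ := h₂.lift (t ≫ pullback.snd p q) (by
    rw [Category.assoc, ← pullback.condition, reassoc_of% ht, zero_comp])
  refine ⟨l, ?_⟩
  apply pullback.hom_ext
  · simpa [pullback.lift_fst, pullback.lift_snd, pushout.inl_desc, pushout.inr_desc, pullback.lift_fst_assoc, pullback.lift_snd_assoc, pushout.inl_desc_assoc, pushout.inr_desc_assoc] using ht.symm
  · simpa [pullback.lift_fst, pullback.lift_snd, pushout.inl_desc, pushout.inr_desc, pullback.lift_fst_assoc, pullback.lift_snd_assoc, pushout.inl_desc_assoc, pushout.inr_desc_assoc] using hl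

lemma HasSES16.po_mono {A E D E₂ D₂ : C} (h₁ : HasSES16 A E D) (h₂ : HasSES16 A E₂ D₂) :
    ∃ E', HasSES16 E E' D₂ ∧ HasSES16 E₂ E' D := by
  obtain ⟨i, p, h₁⟩ := h₁
  obtain ⟨j, q, h₂⟩ := h₂
  refine ⟨pushout i j, ?_, ⟨_, _, h₁.pushout j⟩⟩
  have := h₂.mono
  have := h₂.epi
  have hw : i ≫ (0 : E ⟶ D₂) = j ≫ q := by rw [h₂.zero, comp_zero]
  have hm : Epi (pushout.desc 0 q hw) := by
    have : Epi (pushout.inr i j ≫ pushout.desc 0 q hw) := by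
      rw [pushout.inr_desc]; infer_instance
    exact epi_of_epi (pushout.inr i j) _
  refine ⟨pushout.inl i j, pushout.desc 0 q hw, SES16.of_desc _ _ (by simp [pullback.lift_fst, pullback.lift_snd, pushout.inl_desc, pushout.inr_desc, pullback.lift_fst_assoc, pullback.lift_snd_assoc, pushout.inl_desc_assoc, pushout.inr_desc_assoc]) ?_⟩
  intro T t ht
  obtain ⟨l, hl⟩ := h₂.desc (pushout.inr i j ≫ t) (by
    rw [← Category.assoc, ← pushout.condition, Category.assoc, ht, comp_zero])
  refine ⟨l, ?_⟩
  apply pushout.hom_ext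
  · simpa [pullback.lift_fst, pullback.lift_snd, pushout.inl_desc, pushout.inr_desc, pullback.lift_fst_assoc, pullback.lift_snd_assoc, pushout.inl_desc_assoc, pushout.inr_desc_assoc] using ht.symm
  · simpa [pullback.lift_fst, pullback.lift_snd, pushout.inl_desc, pushout.inr_desc, pullback.lift_fst_assoc, pullback.lift_snd_assoc, pushout.inl_desc_assoc, pushout.inr_desc_assoc] using hl

lemma HasSES16.pb_mono {K E B B' D : C} (h₁ : HasSES16 K E B) (h₂ : HasSES16 B' B D) :
    ∃ E', HasSES16 K E' B' ∧ HasSES16 E' E D := by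
  obtain ⟨i, p, h₁⟩ := h₁
  obtain ⟨j, q, h₂⟩ := h₂
  refine ⟨pullback p j, ⟨_, _, h₁.pullback j⟩, pullback.fst p j, p ≫ q, ?_⟩
  have := h₂.mono
  have := h₂.epi
  have := h₁.epi
  refine SES16.of_lift _ _ ?_ ?_
  · rw [← Category.assoc, pullback.condition, Category.assoc, h₂.zero, comp_zero]
  intro T t ht
  obtain ⟨l, hl⟩ := h₂.lift (t ≫ p) (by rw [Category.assoc, ht])
  exact ⟨pullback.lift t l hl.symm, by simp [pullback.lift_fst, pullback.lift_snd, pushout.inl_desc, pushout.inr_desc, pullback.lift_fst_assoc, pullback.lift_snd_assoc, pushout.inl_desc_assoc, pushout.inr_desc_assoc]⟩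

lemma HasSES16.po_epi {A E D L A' : C} (h₁ : HasSES16 A E D) (h₂ : HasSES16 L A A') :
    ∃ E', HasSES16 A' E' D ∧ HasSES16 L E E' := by
  obtain ⟨i, p, h₁⟩ := h₁
  obtain ⟨j, q, h₂⟩ := h₂
  refine ⟨pushout i q, ⟨_, _, h₁.pushout q⟩, j ≫ i, pushout.inl i q, ?_⟩
  have := h₂.mono
  have := h₂.epi
  have := h₁.mono
  refine SES16.of_desc _ _ ?_ ?_
  · rw [Category.assoc, pushout.condition, ← Category.assoc, h₂.zero, zero_comp]
  intro T t ht
  obtain ⟨l, hl⟩ := h₂.desc (i ≫ t) (by rw [← Category.assoc, ht])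
  exact ⟨pushout.desc t l hl.symm, by simp [pullback.lift_fst, pullback.lift_snd, pushout.inl_desc, pushout.inr_desc, pullback.lift_fst_assoc, pullback.lift_snd_assoc, pushout.inl_desc_assoc, pushout.inr_desc_assoc]⟩

/-! Extension and lifting from vanishing of `Ext¹`. -/

lemma SES16.lift_of_ext {K E V X : C} {i : K ⟶ E} {p : E ⟶ V} (h : SES16 i p)
    (hX : Subsingleton (Ext X K 1)) (a : X ⟶ V) : ∃ a' : X ⟶ E, a' ≫ p = a := by
  obtain ⟨w, hs⟩ := h
  obtain ⟨x, hx⟩ := Ext.covariant_sequence_exact₃ X hs (Ext.mk₀ a) (n₁ := 1) (by simp)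
    (Subsingleton.elim (α := Ext X K 1) _ _)
  obtain ⟨a', rfl⟩ := (Ext.mk₀_bijective _ _).2 x
  refine ⟨a', (Ext.mk₀_bijective _ _).1 ?_⟩
  rw [← hx, Ext.mk₀_comp_mk₀]

lemma SES16.extend_of_ext {V E K Y : C} {i : V ⟶ E} {p : E ⟶ K} (h : SES16 i p)
    (hY : Subsingleton (Ext K Y 1)) (a : V ⟶ Y) : ∃ a' : E ⟶ Y, i ≫ a' = a := by
  obtain ⟨w, hs⟩ := h
  obtain ⟨x, hx⟩ := Ext.contravariant_sequence_exact₁ hs Y (Ext.mk₀ a) (n₁ := 1) (by simp)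
    (Subsingleton.elim (α := Ext K Y 1) _ _)
  obtain ⟨a', rfl⟩ := (Ext.mk₀_bijective _ _).2 x
  refine ⟨a', (Ext.mk₀_bijective _ _).1 ?_⟩
  rw [← hx, Ext.mk₀_comp_mk₀]

/-! Vanishing of Ext along short exact sequences. -/

lemma HasSES16.ext_mid_cov {X Y Z T : C} (h : HasSES16 X Y Z) (n : ℕ)
    (h₁ : Subsingleton (Ext T X n)) (h₂ : Subsingleton (Ext T Z n)) :
    Subsingleton (Ext T Y n) := by
  obtain ⟨i, p, w, hs⟩ := h
  refine subsingleton_of_forall_eq 0 fun y => ?_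
  obtain ⟨x, rfl⟩ := Ext.covariant_sequence_exact₂ T hs y (Subsingleton.elim (α := Ext T Z n) _ _)
  rw [Subsingleton.elim (α := Ext T X n) x 0, Ext.zero_comp]

lemma HasSES16.ext_mid_contra {X Y Z T : C} (h : HasSES16 X Y Z) (n : ℕ)
    (h₁ : Subsingleton (Ext X T n)) (h₂ : Subsingleton (Ext Z T n)) :
    Subsingleton (Ext Y T n) := by
  obtain ⟨i, p, w, hs⟩ := h
  refine subsingleton_of_forall_eq 0 fun y => ?_
  obtain ⟨x, rfl⟩ := Ext.contravariant_sequence_exact₂ hs T y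
    (Subsingleton.elim (α := Ext X T n) _ _)
  rw [Subsingleton.elim (α := Ext Z T n) x 0, Ext.comp_zero]

lemma HasSES16.ext_right_cov {X Y Z T : C} (h : HasSES16 X Y Z) (n : ℕ)
    (h₁ : Subsingleton (Ext T Y n)) (h₂ : Subsingleton (Ext T X (n + 1))) :
    Subsingleton (Ext T Z n) := by
  obtain ⟨i, p, w, hs⟩ := h
  refine subsingleton_of_forall_eq 0 fun y => ?_
  obtain ⟨x, rfl⟩ := Ext.covariant_sequence_exact₃ T hs y (n₁ := n + 1) rfl
    (Subsingleton.elim (α := Ext T X (n + 1)) _ _)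
  rw [Subsingleton.elim (α := Ext T Y n) x 0, Ext.zero_comp]

lemma HasSES16.ext_left_contra {X Y Z T : C} (h : HasSES16 X Y Z) (n : ℕ)
    (h₁ : Subsingleton (Ext Y T n)) (h₂ : Subsingleton (Ext Z T (n + 1))) :
    Subsingleton (Ext X T n) := by
  obtain ⟨i, p, w, hs⟩ := h
  refine subsingleton_of_forall_eq 0 fun y => ?_
  obtain ⟨x, rfl⟩ := Ext.contravariant_sequence_exact₁ hs T y (n₁ := n + 1) (add_comm _ _)
    (Subsingleton.elim (α := Ext Z T (n + 1)) _ _)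
  rw [Subsingleton.elim (α := Ext Y T n) x 0, Ext.comp_zero]

/-! Closure properties. -/

variable (M : HoveyTriple.{w} C)

lemma HoveyTriple.Q_mid {X Y Z : C} (h : HasSES16 X Y Z) (hX : M.Q X) (hZ : M.Q Z) : M.Q Y :=
  M.orth₁_left fun _ hW hR => h.ext_mid_contra 1 (M.orth₁ hX hW hR) (M.orth₁ hZ hW hR)

lemma HoveyTriple.Q_left {X Y Z : C} (h : HasSES16 X Y Z) (hY : M.Q Y) (hZ : M.Q Z) : M.Q X :=
  M.orth₁_left fun _ hW hR => h.ext_left_contra 1 (M.orth₁ hY hW hR)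
    (M.hereditary₁ 2 (by norm_num) hZ hW hR)

lemma HoveyTriple.R_mid {X Y Z : C} (h : HasSES16 X Y Z) (hX : M.R X) (hZ : M.R Z) : M.R Y :=
  M.orth₂_right fun _ hQ hW => h.ext_mid_cov 1 (M.orth₂ hQ hW hX) (M.orth₂ hQ hW hZ)

lemma HoveyTriple.R_right {X Y Z : C} (h : HasSES16 X Y Z) (hX : M.R X) (hY : M.R Y) : M.R Z :=
  M.orth₂_right fun _ hQ hW => h.ext_right_cov 1 (M.orth₂ hQ hW hY)
    (M.hereditary₂ 2 (by norm_num) hQ hW hX)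

lemma HoveyTriple.W_right {X Y Z : C} (h : HasSES16 X Y Z) (hX : M.W X) (hY : M.W Y) : M.W Z := by
  obtain ⟨i, p, w, hs⟩ := h
  exact (M.thick_two_of_three i p w hs).1 hX hY

lemma HoveyTriple.W_mid {X Y Z : C} (h : HasSES16 X Y Z) (hX : M.W X) (hZ : M.W Z) : M.W Y := by
  obtain ⟨i, p, w, hs⟩ := h
  exact (M.thick_two_of_three i p w hs).2.1 hX hZ

lemma HoveyTriple.W_left {X Y Z : C} (h : HasSES16 X Y Z) (hY : M.W Y) (hZ : M.W Z) : M.W X := by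
  obtain ⟨i, p, w, hs⟩ := h
  exact (M.thick_two_of_three i p w hs).2.2 hY hZ

lemma HasSES16.biprod (X Y : C) : HasSES16 X (X ⊞ Y) Y := by
  refine ⟨biprod.inl, biprod.snd, SES16.of_lift _ _ (by simp) ?_⟩
  intro T t ht
  refine ⟨t ≫ biprod.fst, ?_⟩
  apply biprod.hom_ext
  · simp
  · simpa using ht.symm

/-- cofibrant replacement, existence -/
lemma HoveyTriple.exists_cofRep (A : C) : ∃ QA, IsCofRep M QA A := by
  obtain ⟨K, E, i, p, w, hE, hK, hK', hs⟩ := M.complete₁_proj A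
  exact ⟨E, hE, K, i, p, w, hK, hK', hs⟩

lemma HoveyTriple.exists_fibRep (A : C) : ∃ RA, IsFibRep M RA A := by
  obtain ⟨E, K, i, p, w, hE, hK, hK', hs⟩ := M.complete₂_inj A
  exact ⟨E, hE, K, i, p, w, hK, hK', hs⟩

/-! Maps factoring through `𝒲`. -/

/-- `f` factors through a trivial object. -/
def FactW16 {X Y : C} (f : X ⟶ Y) : Prop := ∃ V, M.W V ∧ ∃ (a : X ⟶ V) (b : V ⟶ Y), f = a ≫ b

variable {M}

lemma FactW16.pre {X Y Z : C} {f : X ⟶ Y} (h : FactW16 M f) (g : Z ⟶ X) : FactW16 M (g ≫ f) := by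
  obtain ⟨V, hV, a, b, rfl⟩ := h
  exact ⟨V, hV, g ≫ a, b, by simp⟩

lemma FactW16.post {X Y Z : C} {f : X ⟶ Y} (h : FactW16 M f) (g : Y ⟶ Z) : FactW16 M (f ≫ g) := by
  obtain ⟨V, hV, a, b, rfl⟩ := h
  exact ⟨V, hV, a, b ≫ g, by simp⟩

lemma FactW16.neg {X Y : C} {f : X ⟶ Y} (h : FactW16 M f) : FactW16 M (-f) := by
  obtain ⟨V, hV, a, b, rfl⟩ := h
  exact ⟨V, hV, -a, b, by simp⟩

lemma FactW16.add {X Y : C} {f g : X ⟶ Y} (h : FactW16 M f) (h' : FactW16 M g) :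
    FactW16 M (f + g) := by
  obtain ⟨V, hV, a, b, rfl⟩ := h
  obtain ⟨V', hV', a', b', rfl⟩ := h'
  exact ⟨V ⊞ V', M.W_mid (HasSES16.biprod V V') hV hV', biprod.lift a a', biprod.desc b b',
    by simp⟩

/-- A map from a cofibrant object through `𝒲` factors through `𝒬 ∩ 𝒲`. -/
lemma FactW16.toQ {X Y : C} {f : X ⟶ Y} (h : FactW16 M f) (hX : M.Q X) :
    ∃ V, M.Q V ∧ M.W V ∧ ∃ (a : X ⟶ V) (b : V ⟶ Y), f = a ≫ b := by
  obtain ⟨V, hV, a, b, rfl⟩ := h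
  obtain ⟨E, hE, K, i, p, w, hK, hK', hs⟩ := M.exists_cofRep V
  obtain ⟨a', rfl⟩ := SES16.lift_of_ext (i := i) ⟨w, hs⟩ (M.orth₁ hX hK hK') a
  exact ⟨E, hE, M.W_mid ⟨i, p, w, hs⟩ hK hV, a', p ≫ b, by simp⟩

lemma FactW16.toR {X Y : C} {f : X ⟶ Y} (h : FactW16 M f) (hY : M.R Y) :
    ∃ V, M.R V ∧ M.W V ∧ ∃ (a : X ⟶ V) (b : V ⟶ Y), f = a ≫ b := by
  obtain ⟨V, hV, a, b, rfl⟩ := h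
  obtain ⟨E, hE, K, i, p, w, hK, hK', hs⟩ := M.exists_fibRep V
  obtain ⟨b', rfl⟩ := SES16.extend_of_ext (p := p) ⟨w, hs⟩ (M.orth₂ hK hK' hY) b
  exact ⟨E, hE, M.W_mid ⟨i, p, w, hs⟩ hV hK', a ≫ i, b', by simp⟩

lemma FactW16.toω {X Y : C} {f : X ⟶ Y} (h : FactW16 M f) (hX : M.Q X) (hY : M.R Y) :
    ∃ V, (M.Q V ∧ M.W V ∧ M.R V) ∧ ∃ (a : X ⟶ V) (b : V ⟶ Y), f = a ≫ b := by
  obtain ⟨V, hQ, hV, a, b, rfl⟩ := h.toQ hX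
  obtain ⟨E, hE, K, i, p, w, hK, hK', hs⟩ := M.exists_fibRep V
  obtain ⟨b', rfl⟩ := SES16.extend_of_ext (p := p) ⟨w, hs⟩ (M.orth₂ hK hK' hY) b
  exact ⟨E, ⟨M.Q_mid ⟨i, p, w, hs⟩ hQ hK, M.W_mid ⟨i, p, w, hs⟩ hV hK', hE⟩, a ≫ i, b', by simp⟩

lemma mem_omega16 {X Y : C} (f : X ⟶ Y) (hX : M.Q X) (hY : M.R Y) :
    f ∈ omegaFactorSub M X Y ↔ FactW16 M f := by
  constructor
  · intro h
    have h0 : FactW16 M (0 : X ⟶ Y) := by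
      obtain ⟨V, Z, i, p, w, hV, _⟩ := M.complete₁_inj X
      exact ⟨V, hV, 0, 0, by simp⟩
    refine AddSubgroup.closure_induction (p := fun g _ => FactW16 M g) ?_ h0
      (fun _ _ _ _ h h' => h.add h') (fun _ _ h => h.neg) h
    rintro g ⟨ω, hω, a, b, rfl⟩
    exact ⟨ω, hω.2.1, a, b, rfl⟩
  · intro h
    exact AddSubgroup.subset_closure (h.toω hX hY)

/-- universal property of `hoHom` -/
lemma hoHom_equiv16 {X Y : C} (hX : M.Q X) (hY : M.R Y) {G : Type*} [AddCommGroup G]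
    (φ : (X ⟶ Y) →+ G) (hφ : Function.Surjective φ) (hk : ∀ f, φ f = 0 ↔ FactW16 M f) :
    Nonempty (hoHom M X Y ≃+ G) := by
  have hker : omegaFactorSub M X Y = φ.ker := by
    ext f
    rw [mem_omega16 f hX hY, AddMonoidHom.mem_ker, hk]
  exact ⟨(QuotientAddGroup.quotientAddEquivOfEq hker).trans
    (QuotientAddGroup.quotientKerEquivOfSurjective φ hφ)⟩

/-- the projection to `hoHom` -/
noncomputable def hoMk16 (M : HoveyTriple.{w} C) (X Y : C) : (X ⟶ Y) →+ hoHom M X Y :=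
  QuotientAddGroup.mk' (omegaFactorSub M X Y)

lemma hoMk16_surj (X Y : C) : Function.Surjective (hoMk16 M X Y) :=
  QuotientAddGroup.mk'_surjective _

lemma hoMk16_eq_zero {X Y : C} (hX : M.Q X) (hY : M.R Y) (f : X ⟶ Y) :
    hoMk16 M X Y f = 0 ↔ FactW16 M f := by
  rw [← mem_omega16 f hX hY]
  exact QuotientAddGroup.eq_zero_iff f

/-! Dimension shifting. -/

lemma shift_left16 {X P S Y : C} (h : HasSES16 X P S) (hQ : M.Q P) (hW : M.W P) (hS : M.Q S)
    (hY : M.R Y) :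
    Nonempty (hoHom M X Y ≃+ Ext S Y 1) ∧
      ∀ n, 1 ≤ n → Nonempty (Ext X Y n ≃+ Ext S Y (n + 1)) := by
  have hX := M.Q_left h hQ hS
  obtain ⟨i, p, w, hs⟩ := h
  constructor
  · let φ : (X ⟶ Y) →+ Ext S Y 1 :=
      (hs.extClass.precomp Y (add_zero 1)).comp Ext.addEquiv₀.symm.toAddMonoidHom
    have hφ : ∀ f, φ f = hs.extClass.comp (Ext.mk₀ f) (add_zero 1) := fun f => rfl
    refine hoHom_equiv16 hX hY φ ?_ ?_
    · intro x
      have := M.orth₂ hQ hW hY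
      obtain ⟨y, hy⟩ := Ext.contravariant_sequence_exact₃ hs Y x
        (Subsingleton.elim (α := Ext P Y 1) _ _) (n₀ := 0) (add_zero 1)
      obtain ⟨f, rfl⟩ := (Ext.mk₀_bijective _ _).2 y
      exact ⟨f, by rw [hφ, hy]⟩
    · intro f
      rw [hφ]
      constructor
      · intro hf
        obtain ⟨y, hy⟩ := Ext.contravariant_sequence_exact₁ hs Y (Ext.mk₀ f) (add_zero 1) hf
        obtain ⟨g, rfl⟩ := (Ext.mk₀_bijective _ _).2 y
        refine ⟨P, hW, i, g, (Ext.mk₀_bijective _ _).1 ?_⟩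
        rw [← hy, Ext.mk₀_comp_mk₀]
      · intro hf
        obtain ⟨V, ⟨hVQ, hVW, hVR⟩, a, b, rfl⟩ := hf.toω hX hY
        obtain ⟨a', rfl⟩ := SES16.extend_of_ext (p := p) ⟨w, hs⟩ (M.orth₁ hS hVW hVR) a
        rw [Category.assoc, ← Ext.mk₀_comp_mk₀]
        exact hs.extClass_comp_assoc (Ext.mk₀ (a' ≫ b))
  · intro n hn
    refine ⟨AddEquiv.ofBijective (hs.extClass.precomp Y (add_comm 1 n)) ⟨?_, ?_⟩⟩
    · rw [injective_iff_map_eq_zero]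
      intro x hx
      obtain ⟨y, rfl⟩ := Ext.contravariant_sequence_exact₁ hs Y x (add_comm 1 n) hx
      have := M.hereditary₂ n hn hQ hW hY
      rw [Subsingleton.elim (α := Ext P Y n) y 0, Ext.comp_zero]
    · intro x
      have := M.hereditary₂ (n + 1) (by omega) hQ hW hY
      obtain ⟨y, hy⟩ := Ext.contravariant_sequence_exact₃ hs Y x
        (Subsingleton.elim (α := Ext P Y (n + 1)) _ _) (add_comm 1 n)
      exact ⟨y, hy⟩

lemma shift_right16 {X P T Y : C} (h : HasSES16 T P Y) (hR : M.R P) (hW : M.W P) (hT : M.R T)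
    (hX : M.Q X) :
    Nonempty (hoHom M X Y ≃+ Ext X T 1) ∧
      ∀ n, 1 ≤ n → Nonempty (Ext X Y n ≃+ Ext X T (n + 1)) := by
  have hY := M.R_right h hT hR
  obtain ⟨i, p, w, hs⟩ := h
  constructor
  · let φ : (X ⟶ Y) →+ Ext X T 1 :=
      (hs.extClass.postcomp X (zero_add 1)).comp Ext.addEquiv₀.symm.toAddMonoidHom
    have hφ : ∀ f, φ f = (Ext.mk₀ f).comp hs.extClass (zero_add 1) := fun f => rfl
    refine hoHom_equiv16 hX hY φ ?_ ?_
    · intro x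
      have := M.orth₁ hX hW hR
      obtain ⟨y, hy⟩ := Ext.covariant_sequence_exact₁ X hs x
        (Subsingleton.elim (α := Ext X P 1) _ _) (n₀ := 0) (zero_add 1)
      obtain ⟨f, rfl⟩ := (Ext.mk₀_bijective _ _).2 y
      exact ⟨f, by rw [hφ, hy]⟩
    · intro f
      rw [hφ]
      constructor
      · intro hf
        obtain ⟨y, hy⟩ := Ext.covariant_sequence_exact₃ X hs (Ext.mk₀ f) (zero_add 1) hf
        obtain ⟨g, rfl⟩ := (Ext.mk₀_bijective _ _).2 y
        refine ⟨P, hW, g, p, (Ext.mk₀_bijective _ _).1 ?_⟩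
        rw [← hy, Ext.mk₀_comp_mk₀]
      · intro hf
        obtain ⟨V, ⟨hVQ, hVW, hVR⟩, a, b, rfl⟩ := hf.toω hX hY
        obtain ⟨b', rfl⟩ := SES16.lift_of_ext (i := i) ⟨w, hs⟩ (M.orth₂ hVQ hVW hT) b
        rw [← Category.assoc, ← Ext.mk₀_comp_mk₀, Ext.comp_assoc_of_second_deg_zero]
        have := hs.comp_extClass
        dsimp at this
        rw [this, Ext.comp_zero]
  · intro n hn
    refine ⟨AddEquiv.ofBijective (hs.extClass.postcomp X rfl) ⟨?_, ?_⟩⟩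
    · rw [injective_iff_map_eq_zero]
      intro x hx
      obtain ⟨y, rfl⟩ := Ext.covariant_sequence_exact₃ X hs x rfl hx
      have := M.hereditary₁ n hn hX hW hR
      rw [Subsingleton.elim (α := Ext X P n) y 0, Ext.zero_comp]
    · intro x
      have := M.hereditary₁ (n + 1) (by omega) hX hW hR
      obtain ⟨y, hy⟩ := Ext.covariant_sequence_exact₁ X hs x
        (Subsingleton.elim (α := Ext X P (n + 1)) _ _) rfl
      exact ⟨y, hy⟩

/-! Homotopy invariance. -/

lemma FactW16.ext_right {X Y Y' : C} {f : Y ⟶ Y'} (h : FactW16 M f) (hX : M.Q X) (hY : M.R Y')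
    {n : ℕ} (hn : 1 ≤ n) (x : Ext X Y n) : x.comp (Ext.mk₀ f) (add_zero n) = 0 := by
  obtain ⟨V, hR, hW, a, b, rfl⟩ := h.toR hY
  have := M.hereditary₁ n hn hX hW hR
  rw [← Ext.mk₀_comp_mk₀, ← Ext.comp_assoc_of_third_deg_zero,
    Subsingleton.elim (α := Ext X V n) (x.comp (Ext.mk₀ a) (add_zero n)) 0, Ext.zero_comp]

lemma FactW16.ext_left {X X' Y : C} {f : X' ⟶ X} (h : FactW16 M f) (hX : M.Q X') (hY : M.R Y)
    {n : ℕ} (hn : 1 ≤ n) (x : Ext X Y n) : (Ext.mk₀ f).comp x (zero_add n) = 0 := by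
  obtain ⟨V, hR, hW, a, b, rfl⟩ := h.toQ hX
  have := M.hereditary₂ n hn hR hW hY
  rw [← Ext.mk₀_comp_mk₀_assoc,
    Subsingleton.elim (α := Ext V Y n) ((Ext.mk₀ b).comp x (zero_add n)) 0, Ext.comp_zero]

lemma htpy_right16 {X Y₁ Y₂ : C} (hX : M.Q X) (h₁ : M.R Y₁) (h₂ : M.R Y₂)
    (a : Y₁ ⟶ Y₂) (b : Y₂ ⟶ Y₁) (hab : FactW16 M (a ≫ b - 𝟙 _)) (hba : FactW16 M (b ≫ a - 𝟙 _)) :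
    Nonempty (hoHom M X Y₁ ≃+ hoHom M X Y₂) ∧
      ∀ n, 1 ≤ n → Nonempty (Ext X Y₁ n ≃+ Ext X Y₂ n) := by
  constructor
  · let c : (X ⟶ Y₁) →+ (X ⟶ Y₂) := AddMonoidHom.mk' (fun f => f ≫ a) (by simp)
    have hc : ∀ f, c f = f ≫ a := fun _ => rfl
    refine hoHom_equiv16 hX h₁ ((hoMk16 M X Y₂).comp c) ?_ ?_
    · intro x
      obtain ⟨g, rfl⟩ := hoMk16_surj X Y₂ x
      refine ⟨g ≫ b, ?_⟩
      rw [AddMonoidHom.comp_apply, hc, ← sub_eq_zero, ← map_sub, hoMk16_eq_zero hX h₂]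
      have := hba.pre g
      simpa using this
    · intro f
      rw [AddMonoidHom.comp_apply, hc, hoMk16_eq_zero hX h₂]
      refine ⟨fun h => ?_, fun h => h.post a⟩
      have := (h.post b).add (hab.pre f).neg
      simpa using this
  · intro n hn
    refine ⟨AddEquiv.ofBijective ((Ext.mk₀ a).postcomp X (add_zero n)) ⟨?_, ?_⟩⟩
    · rw [injective_iff_map_eq_zero]
      intro x hx
      have hx' : x.comp (Ext.mk₀ a) (add_zero n) = 0 := hx
      have := hab.ext_right hX h₁ hn x
      rw [sub_eq_add_neg, Ext.mk₀_add, Ext.mk₀_neg, Ext.comp_add, ← Ext.mk₀_comp_mk₀,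
        ← Ext.comp_assoc_of_third_deg_zero, hx', Ext.zero_comp] at this
      simpa using this
    · intro x
      refine ⟨x.comp (Ext.mk₀ b) (add_zero n), ?_⟩
      change (x.comp (Ext.mk₀ b) (add_zero n)).comp (Ext.mk₀ a) (add_zero n) = x
      have := hba.ext_right hX h₂ hn x
      rw [sub_eq_add_neg, Ext.mk₀_add, Ext.mk₀_neg, Ext.comp_add, ← Ext.mk₀_comp_mk₀,
        ← Ext.comp_assoc_of_third_deg_zero] at this
      simpa [← sub_eq_add_neg, sub_eq_zero] using this

lemma htpy_left16 {X₁ X₂ Y : C} (h₁ : M.Q X₁) (h₂ : M.Q X₂) (hY : M.R Y)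
    (a : X₁ ⟶ X₂) (b : X₂ ⟶ X₁) (hab : FactW16 M (a ≫ b - 𝟙 _)) (hba : FactW16 M (b ≫ a - 𝟙 _)) :
    Nonempty (hoHom M X₁ Y ≃+ hoHom M X₂ Y) ∧
      ∀ n, 1 ≤ n → Nonempty (Ext X₁ Y n ≃+ Ext X₂ Y n) := by
  constructor
  · let c : (X₁ ⟶ Y) →+ (X₂ ⟶ Y) := AddMonoidHom.mk' (fun f => b ≫ f) (by simp)
    have hc : ∀ f, c f = b ≫ f := fun _ => rfl
    refine hoHom_equiv16 h₁ hY ((hoMk16 M X₂ Y).comp c) ?_ ?_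
    · intro x
      obtain ⟨g, rfl⟩ := hoMk16_surj X₂ Y x
      refine ⟨a ≫ g, ?_⟩
      rw [AddMonoidHom.comp_apply, hc, ← sub_eq_zero, ← map_sub, hoMk16_eq_zero h₂ hY]
      have := hba.post g
      simpa using this
    · intro f
      rw [AddMonoidHom.comp_apply, hc, hoMk16_eq_zero h₂ hY]
      refine ⟨fun h => ?_, fun h => h.pre b⟩
      have := (h.pre a).add (hab.post f).neg
      simpa using this
  · intro n hn
    refine ⟨AddEquiv.ofBijective ((Ext.mk₀ b).precomp Y (zero_add n)) ⟨?_, ?_⟩⟩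
    · rw [injective_iff_map_eq_zero]
      intro x hx
      have hx' : (Ext.mk₀ b).comp x (zero_add n) = 0 := hx
      have := hab.ext_left h₁ hY hn x
      rw [sub_eq_add_neg, Ext.mk₀_add, Ext.mk₀_neg, Ext.add_comp, ← Ext.mk₀_comp_mk₀_assoc,
        hx', Ext.comp_zero] at this
      simpa using this
    · intro x
      refine ⟨(Ext.mk₀ a).comp x (zero_add n), ?_⟩
      change (Ext.mk₀ b).comp ((Ext.mk₀ a).comp x (zero_add n)) (zero_add n) = x
      have := hba.ext_left h₂ hY hn x
      rw [sub_eq_add_neg, Ext.mk₀_add, Ext.mk₀_neg, Ext.add_comp, ← Ext.mk₀_comp_mk₀_assoc] at this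
      simpa [← sub_eq_add_neg, sub_eq_zero] using this

/-! Uniqueness of replacements. -/

lemma cofRep_unique16 {Q₁ Q₂ A Y : C} (h₁ : IsCofRep M Q₁ A) (h₂ : IsCofRep M Q₂ A) (hY : M.R Y) :
    Nonempty (hoHom M Q₁ Y ≃+ hoHom M Q₂ Y) ∧
      ∀ n, 1 ≤ n → Nonempty (Ext Q₁ Y n ≃+ Ext Q₂ Y n) := by
  obtain ⟨hQ₁, K₁, i₁, p₁, w₁, hW₁, hR₁, hs₁⟩ := h₁
  obtain ⟨hQ₂, K₂, i₂, p₂, w₂, hW₂, hR₂, hs₂⟩ := h₂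
  have s₁ : SES16 i₁ p₁ := ⟨w₁, hs₁⟩
  have s₂ : SES16 i₂ p₂ := ⟨w₂, hs₂⟩
  obtain ⟨a, ha⟩ := s₂.lift_of_ext (M.orth₁ hQ₁ hW₂ hR₂) p₁
  obtain ⟨b, hb⟩ := s₁.lift_of_ext (M.orth₁ hQ₂ hW₁ hR₁) p₂
  refine htpy_left16 hQ₁ hQ₂ hY a b ?_ ?_
  · obtain ⟨l, hl⟩ := s₁.lift (a ≫ b - 𝟙 _) (by simp [ha, hb])
    exact ⟨K₁, hW₁, l, i₁, hl.symm⟩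
  · obtain ⟨l, hl⟩ := s₂.lift (b ≫ a - 𝟙 _) (by simp [ha, hb])
    exact ⟨K₂, hW₂, l, i₂, hl.symm⟩

lemma fibRep_unique16 {R₁ R₂ B X : C} (h₁ : IsFibRep M R₁ B) (h₂ : IsFibRep M R₂ B) (hX : M.Q X) :
    Nonempty (hoHom M X R₁ ≃+ hoHom M X R₂) ∧
      ∀ n, 1 ≤ n → Nonempty (Ext X R₁ n ≃+ Ext X R₂ n) := by
  obtain ⟨hR₁, K₁, i₁, p₁, w₁, hQ₁, hW₁, hs₁⟩ := h₁
  obtain ⟨hR₂, K₂, i₂, p₂, w₂, hQ₂, hW₂, hs₂⟩ := h₂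
  have s₁ : SES16 i₁ p₁ := ⟨w₁, hs₁⟩
  have s₂ : SES16 i₂ p₂ := ⟨w₂, hs₂⟩
  obtain ⟨a, ha⟩ := s₁.extend_of_ext (M.orth₂ hQ₁ hW₁ hR₂) i₂
  obtain ⟨b, hb⟩ := s₂.extend_of_ext (M.orth₂ hQ₂ hW₂ hR₁) i₁
  refine htpy_right16 hX hR₁ hR₂ a b ?_ ?_
  · obtain ⟨l, hl⟩ := s₁.desc (a ≫ b - 𝟙 _) (by simp [reassoc_of% ha, hb])
    exact ⟨K₁, hW₁, p₁, l, hl.symm⟩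
  · obtain ⟨l, hl⟩ := s₂.desc (b ≫ a - 𝟙 _) (by simp [reassoc_of% hb, ha])
    exact ⟨K₂, hW₂, p₂, l, hl.symm⟩

/-- Passing from `X` cofibrant to its fibrant replacement does not change maps to fibrant `Y`. -/
lemma hoHom_fibRep16 {X RX Y : C} (h : IsFibRep M RX X) (hX : M.Q X) (hY : M.R Y) :
    Nonempty (hoHom M RX Y ≃+ hoHom M X Y) := by
  obtain ⟨hR, Z, i, p, w, hZQ, hZW, hs⟩ := h
  have s : SES16 i p := ⟨w, hs⟩
  let c : (RX ⟶ Y) →+ (X ⟶ Y) := AddMonoidHom.mk' (fun f => i ≫ f) (by simp)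
  have hc : ∀ f, c f = i ≫ f := fun _ => rfl
  refine hoHom_equiv16 (M.Q_mid ⟨i, p, s⟩ hX hZQ) hY ((hoMk16 M X Y).comp c) ?_ ?_
  · intro x
    obtain ⟨g, rfl⟩ := hoMk16_surj X Y x
    obtain ⟨f, rfl⟩ := s.extend_of_ext (M.orth₂ hZQ hZW hY) g
    exact ⟨f, rfl⟩
  · intro f
    rw [AddMonoidHom.comp_apply, hc, hoMk16_eq_zero hX hY]
    refine ⟨fun h => ?_, fun h => h.pre i⟩
    obtain ⟨V, hVR, hVW, a, b, hab⟩ := h.toR hY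
    obtain ⟨a', rfl⟩ := s.extend_of_ext (M.orth₂ hZQ hZW hVR) a
    obtain ⟨l, hl⟩ := s.desc (f - a' ≫ b) (by simp [hab])
    have h1 : FactW16 M (f - a' ≫ b) := ⟨Z, hZW, p, l, hl.symm⟩
    have h2 : FactW16 M (a' ≫ b) := ⟨V, hVW, a', b, rfl⟩
    simpa using h1.add h2

/-! Main shifting lemmas. -/

lemma IsCofRep.hasSES {QA A : C} (h : IsCofRep M QA A) :
    ∃ K, M.W K ∧ M.R K ∧ HasSES16 K QA A := by
  obtain ⟨_, K, i, p, w, hW, hR, hs⟩ := h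
  exact ⟨K, hW, hR, i, p, w, hs⟩

lemma IsFibRep.hasSES {RA A : C} (h : IsFibRep M RA A) :
    ∃ K, M.Q K ∧ M.W K ∧ HasSES16 A RA K := by
  obtain ⟨_, K, i, p, w, hW, hR, hs⟩ := h
  exact ⟨K, hW, hR, i, p, w, hs⟩

lemma IsCofRep.of_ses {QA A K : C} (hQ : M.Q QA) (hW : M.W K) (hR : M.R K)
    (h : HasSES16 K QA A) : IsCofRep M QA A := by
  obtain ⟨i, p, w, hs⟩ := h
  exact ⟨hQ, K, i, p, w, hW, hR, hs⟩

lemma IsFibRep.of_ses {RA A K : C} (hR : M.R RA) (hQ : M.Q K) (hW : M.W K)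
    (h : HasSES16 A RA K) : IsFibRep M RA A := by
  obtain ⟨i, p, w, hs⟩ := h
  exact ⟨hR, K, i, p, w, hQ, hW, hs⟩

lemma main_left16 {O A QO QA Y : C} (hl : IsLoop M O A) (hQO : IsCofRep M QO O)
    (hQA : IsCofRep M QA A) (hY : M.R Y) :
    Nonempty (hoHom M QO Y ≃+ Ext QA Y 1) ∧
      ∀ n, 1 ≤ n → Nonempty (Ext QO Y n ≃+ Ext QA Y (n + 1)) := by
  obtain ⟨V, i, p, w, hV, hs⟩ := hl
  have hl : HasSES16 O V A := ⟨i, p, w, hs⟩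
  obtain ⟨K, hKW, hKR, hK⟩ := hQA.hasSES
  obtain ⟨V', h1, h2⟩ := hl.pb_epi hK
  have hV' := M.W_mid h2 hKW hV
  obtain ⟨V'', hV''⟩ := M.exists_cofRep V'
  obtain ⟨L, hLW, hLR, hL⟩ := hV''.hasSES
  obtain ⟨O', h3, h4⟩ := hL.pb_mono h1
  have hO' : IsCofRep M O' O := IsCofRep.of_ses (M.Q_left h4 hV''.1 hQA.1) hLW hLR h3
  obtain ⟨⟨e0⟩, e⟩ := cofRep_unique16 hQO hO' hY
  obtain ⟨⟨f0⟩, f⟩ := shift_left16 h4 hV''.1 (M.W_mid hL hLW hV') hQA.1 hY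
  refine ⟨⟨e0.trans f0⟩, fun n hn => ?_⟩
  obtain ⟨e1⟩ := e n hn
  obtain ⟨f1⟩ := f n hn
  exact ⟨e1.trans f1⟩

lemma main_right16 {X Y Z RY RZ : C} (hl : IsSusp M Y Z) (hRY : IsFibRep M RY Y)
    (hRZ : IsFibRep M RZ Z) (hX : M.Q X) :
    Nonempty (hoHom M X RZ ≃+ Ext X RY 1) ∧
      ∀ n, 1 ≤ n → Nonempty (Ext X RZ n ≃+ Ext X RY (n + 1)) := by
  obtain ⟨V, i, p, w, hV, hs⟩ := hl
  have hl : HasSES16 Y V Z := ⟨i, p, w, hs⟩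
  obtain ⟨K, hKQ, hKW, hK⟩ := hRY.hasSES
  obtain ⟨V', h2, h1⟩ := hl.po_mono hK
  have hV' := M.W_mid h2 hV hKW
  obtain ⟨V'', hV''⟩ := M.exists_fibRep V'
  obtain ⟨L, hLQ, hLW, hL⟩ := hV''.hasSES
  obtain ⟨Z', h3, h4⟩ := hL.po_epi h1
  have hZ' : IsFibRep M Z' Z := IsFibRep.of_ses (M.R_right h4 hRY.1 hV''.1) hLQ hLW h3
  obtain ⟨⟨e0⟩, e⟩ := fibRep_unique16 hRZ hZ' hX
  obtain ⟨⟨f0⟩, f⟩ := shift_right16 h4 hV''.1 (M.W_mid hL hV' hLW) hRY.1 hX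
  refine ⟨⟨e0.trans f0⟩, fun n hn => ?_⟩
  obtain ⟨e1⟩ := e n hn
  obtain ⟨f1⟩ := f n hn
  exact ⟨e1.trans f1⟩

/-- a suspension can be replaced by its cofibrant replacement -/
lemma IsSusp.cofRep {Y Z QZ : C} (h : IsSusp M Y Z) (hQ : IsCofRep M QZ Z) : IsSusp M Y QZ := by
  obtain ⟨V, i, p, w, hV, hs⟩ := h
  have hl : HasSES16 Y V Z := ⟨i, p, w, hs⟩
  obtain ⟨K, hKW, hKR, hK⟩ := hQ.hasSES
  obtain ⟨V', ⟨i', p', w', hs'⟩, h2⟩ := hl.pb_epi hK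
  exact ⟨V', i', p', w', M.W_mid h2 hKW hV, hs'⟩

lemma ext_fibRep_cofRep16 {X B QB RQB RB : C} (hQB : IsCofRep M QB B) (hRQB : IsFibRep M RQB QB)
    (hRB : IsFibRep M RB B) (hX : M.Q X) {n : ℕ} (hn : 1 ≤ n) :
    Nonempty (Ext X RQB n ≃+ Ext X RB n) := by
  obtain ⟨K, E, i, p, w, _, hW, _, hs⟩ := M.complete₂_proj B
  have hsusp : IsSusp M K B := ⟨E, i, p, w, hW, hs⟩
  obtain ⟨RK, hRK⟩ := M.exists_fibRep K
  obtain ⟨e⟩ := (main_right16 (hsusp.cofRep hQB) hRK hRQB hX).2 n hn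
  obtain ⟨f⟩ := (main_right16 hsusp hRK hRB hX).2 n hn
  exact ⟨e.trans f.symm⟩

lemma tower_left16 {A QA Y : C} (OA : ℕ → C) (hOA0 : OA 0 = A)
    (hOA : ∀ k, IsLoop M (OA (k + 1)) (OA k)) (hQA : IsCofRep M QA A) (hY : M.R Y) (k : ℕ) :
    ∀ (QO : C), IsCofRep M QO (OA k) → ∀ m, 1 ≤ m →
      Nonempty (Ext QO Y m ≃+ Ext QA Y (m + k)) := by
  induction k with
  | zero =>
    intro QO hQO m hm
    rw [hOA0] at hQO
    exact (cofRep_unique16 hQO hQA hY).2 m hm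
  | succ k ih =>
    intro QO hQO m hm
    obtain ⟨Q', hQ'⟩ := M.exists_cofRep (OA k)
    obtain ⟨e⟩ := (main_left16 (hOA k) hQO hQ' hY).2 m hm
    obtain ⟨f⟩ := ih Q' hQ' (m + 1) (by omega)
    rw [show m + (k + 1) = m + 1 + k by omega]
    exact ⟨e.trans f⟩

lemma tower_right16 {B RB X : C} (SB : ℕ → C) (hSB0 : SB 0 = B)
    (hSB : ∀ k, IsSusp M (SB k) (SB (k + 1))) (hRB : IsFibRep M RB B) (hX : M.Q X) (k : ℕ) :
    ∀ (RS : C), IsFibRep M RS (SB k) → ∀ m, 1 ≤ m →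
      Nonempty (Ext X RS m ≃+ Ext X RB (m + k)) := by
  induction k with
  | zero =>
    intro RS hRS m hm
    rw [hSB0] at hRS
    exact (fibRep_unique16 hRS hRB hX).2 m hm
  | succ k ih =>
    intro RS hRS m hm
    obtain ⟨R', hR'⟩ := M.exists_fibRep (SB k)
    obtain ⟨e⟩ := (main_right16 (hSB k) hR' hRS hX).2 m hm
    obtain ⟨f⟩ := ih R' hR' (m + 1) (by omega)
    rw [show m + (k + 1) = m + 1 + k by omega]
    exact ⟨e.trans f⟩

end Aux

/-- for `n ≥ 1`, `Ho(𝔐)(ΩⁿA, B) ≅ Extⁿ(QA, RB) ≅ Ho(𝔐)(A, ΣⁿB)`, where the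
`n`-th loop `ΩⁿA` and suspension `ΣⁿB` are computed from towers of short exact sequences
with trivial middle terms, `QA` is a cofibrant replacement of `A`, `RB` a fibrant
replacement of `B`, and the homotopy-category hom-groups are computed from bifibrant
replacements. -/
theorem statement16 (M : HoveyTriple.{w} C) (A B : C) (n : ℕ) (hn : 1 ≤ n)
    -- a loop tower on `A` : `0 → OA (k+1) → W → OA k → 0` with `W ∈ 𝒲`
    (OA : ℕ → C) (hOA0 : OA 0 = A) (hOA : ∀ k, IsLoop M (OA (k + 1)) (OA k))
    -- a suspension tower on `B` : `0 → SB k → W → SB (k+1) → 0` with `W ∈ 𝒲`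
    (SB : ℕ → C) (hSB0 : SB 0 = B) (hSB : ∀ k, IsSusp M (SB k) (SB (k + 1)))
    -- replacements
    (QA RQA RB : C) (hQA : IsCofRep M QA A) (hRQA : IsFibRep M RQA QA)
    (hRB : IsFibRep M RB B)
    (QOA RQOA : C) (hQOA : IsCofRep M QOA (OA n)) (hRQOA : IsFibRep M RQOA QOA)
    (QB RQB : C) (hQB : IsCofRep M QB B) (hRQB : IsFibRep M RQB QB)
    (QSB RQSB : C) (hQSB : IsCofRep M QSB (SB n)) (hRQSB : IsFibRep M RQSB QSB) :
    Nonempty (hoHom M RQOA RQB ≃+ Abelian.Ext QA RB n) ∧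
    Nonempty (Abelian.Ext QA RB n ≃+ hoHom M RQA RQSB) := by
  obtain ⟨k, rfl⟩ : ∃ k, n = 1 + k := ⟨n - 1, by omega⟩
  constructor
  · obtain ⟨e1⟩ := hoHom_fibRep16 hRQOA hQOA.1 hRQB.1
    obtain ⟨Q', hQ'⟩ := M.exists_cofRep (OA k)
    have hl : IsLoop M (OA (1 + k)) (OA k) := by rw [add_comm]; exact hOA k
    obtain ⟨e2⟩ := (main_left16 hl hQOA hQ' hRQB.1).1
    obtain ⟨e3⟩ := tower_left16 OA hOA0 hOA hQA hRQB.1 k Q' hQ' 1 le_rfl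
    obtain ⟨e4⟩ := ext_fibRep_cofRep16 hQB hRQB hRB hQA.1 hn
    exact ⟨e1.trans (e2.trans (e3.trans e4))⟩
  · obtain ⟨e1⟩ := hoHom_fibRep16 hRQA hQA.1 hRQSB.1
    obtain ⟨R', hR'⟩ := M.exists_fibRep (SB k)
    have hl : IsSusp M (SB k) (SB (1 + k)) := by rw [add_comm]; exact hSB k
    obtain ⟨e2⟩ := (main_right16 (hl.cofRep hQSB) hR' hRQSB hQA.1).1
    obtain ⟨e3⟩ := tower_right16 SB hSB0 hSB hRB hQA.1 k R' hR' 1 le_rfl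
    exact ⟨(e1.trans (e2.trans e3)).symm⟩
end
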